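/- Over the class of all Kripke trees, MPL and WMTL are expressively incomparable, and MPL and WMSO are expressively incomparable. Over the class of finitely-branching Kripke trees, MPL is not subsumed by WMTL, and MPL and WMSO are expressively incomparable. -/

import Mathlib

/-! ## Trees over ℕ* -/

abbrev Node : Type := List ℕ

/-- `T` is a tree with root `r`: `r ∈ T`, every node extends `r`, and `T` is
prefix-closed above `r`. -/
def IsTreeRooted (T : Set Node) (r : Node) : Prop :=
  r ∈ T ∧ (∀ τ ∈ T, r <+: τ) ∧
    ∀ σ σ' : List ℕ, r ++ σ ∈ T → σ' <+: σ → r ++ σ' ∈ T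

/-- `T ⊆ ℕ*` is a tree. -/
def IsTree (T : Set Node) : Prop := ∃ r : Node, IsTreeRooted T r

/-- `τ'` is a child of `τ` in `T`. -/
def childIn (T : Set Node) (τ τ' : Node) : Prop := τ' ∈ T ∧ ∃ n : ℕ, τ' = τ ++ [n]

/-- every node of `T` has a child in `T`. -/
def NonBlocking (T : Set Node) : Prop := ∀ τ ∈ T, ∃ n : ℕ, τ ++ [n] ∈ T

/-- every node of `T` has finitely many children in `T`. -/
def FinBranching (T : Set Node) : Prop := ∀ τ ∈ T, {τ' : Node | childIn T τ τ'}.Finite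

/-- `S` is a subtree of `T`. -/
def IsSubtree (T S : Set Node) : Prop := S ⊆ T ∧ IsTree S

/-- `P` is a path of `T`: a subtree totally ordered by the child relation
(each node has at most one child in `P`). -/
def IsPathOf (T P : Set Node) : Prop :=
  IsSubtree T P ∧ ∀ τ ∈ P, ∀ n m : ℕ, τ ++ [n] ∈ P → τ ++ [m] ∈ P → n = m

/-- `T` is a chain: a tree in which each node has at most one child. -/
def IsChainTree (T : Set Node) : Prop :=
  IsTree T ∧ ∀ τ ∈ T, ∀ n m : ℕ, τ ++ [n] ∈ T → τ ++ [m] ∈ T → n = m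

/-- `T` is dense: it contains a subtree every node of which has a descendant
in the subtree with at least two distinct children in the subtree. -/
def DenseTree (T : Set Node) : Prop :=
  ∃ S : Set Node, IsSubtree T S ∧ ∀ τ ∈ S, ∃ τ' ∈ S, τ <+: τ' ∧
    ∃ n m : ℕ, n ≠ m ∧ τ' ++ [n] ∈ S ∧ τ' ++ [m] ∈ S

/-- A Kripke tree over `AP`: a non-blocking tree together with a labelling. -/
structure KripkeTree (AP : Type) where
  T : Set Node
  root : Node
  rooted : IsTreeRooted T root
  nonblocking : NonBlocking T
  Lab : Node → Set AP

/-! ## MSOL syntax -/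

inductive MSOL (AP : Type) : Type
  | atom : AP → ℕ → MSOL AP          -- P_a(x)
  | le   : ℕ → ℕ → MSOL AP           -- x ≤ y
  | mem  : ℕ → ℕ → MSOL AP           -- x ∈ X
  | not  : MSOL AP → MSOL AP
  | and  : MSOL AP → MSOL AP → MSOL AP
  | exFO : ℕ → MSOL AP → MSOL AP     -- ∃x. φ
  | exSO : ℕ → MSOL AP → MSOL AP     -- ∃X. φ

namespace MSOL

def freeFO {AP : Type} : MSOL AP → Set ℕ
  | atom _ x => {x}
  | le x y => {x, y}
  | mem x _ => {x}
  | not φ => φ.freeFO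
  | and φ ψ => φ.freeFO ∪ ψ.freeFO
  | exFO x φ => φ.freeFO \ {x}
  | exSO _ φ => φ.freeFO

def freeSO {AP : Type} : MSOL AP → Set ℕ
  | atom _ _ => ∅
  | le _ _ => ∅
  | mem _ X => {X}
  | not φ => φ.freeSO
  | and φ ψ => φ.freeSO ∪ ψ.freeSO
  | exFO _ φ => φ.freeSO
  | exSO X φ => φ.freeSO \ {X}

/-- A sentence is a formula with no free variables. -/
def IsSentence {AP : Type} (φ : MSOL AP) : Prop := φ.freeFO = ∅ ∧ φ.freeSO = ∅

/-- The first-order fragment: no second-order variables. -/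
def IsFO {AP : Type} : MSOL AP → Prop
  | atom _ _ => True
  | le _ _ => True
  | mem _ _ => False
  | not φ => φ.IsFO
  | and φ ψ => φ.IsFO ∧ ψ.IsFO
  | exFO _ φ => φ.IsFO
  | exSO _ _ => False

end MSOL

/-! ## MSOL semantics, parametrized by the range of second-order quantifiers -/

/-- A second-order domain: for each tree, the collection of sets that
second-order quantifiers range over. -/
abbrev SODom : Type := Set Node → Set (Set Node)

def Sat {AP : Type} (D : SODom) (K : KripkeTree AP) :
    (ℕ → Node) → (ℕ → Set Node) → MSOL AP → Prop
  | V1, _,  .atom a x => V1 x ∈ K.T ∧ a ∈ K.Lab (V1 x)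
  | V1, _,  .le x y => V1 x ∈ K.T ∧ V1 y ∈ K.T ∧ V1 x <+: V1 y
  | V1, V2, .mem x X => V1 x ∈ V2 X
  | V1, V2, .not φ => ¬ Sat D K V1 V2 φ
  | V1, V2, .and φ ψ => Sat D K V1 V2 φ ∧ Sat D K V1 V2 ψ
  | V1, V2, .exFO x φ => ∃ τ ∈ K.T, Sat D K (Function.update V1 x τ) V2 φ
  | V1, V2, .exSO X φ => ∃ S ∈ D K.T, Sat D K V1 (Function.update V2 X S) φ

/-- A logic: a syntactic fragment of MSOL together with a second-order domain. -/
structure MLogic (AP : Type) where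
  syn : MSOL AP → Prop
  dom : SODom

namespace MLogic

/-- A Kripke tree satisfies a sentence. -/
def KSat {AP : Type} (L : MLogic AP) (K : KripkeTree AP) (φ : MSOL AP) : Prop :=
  ∃ V1 V2, Sat L.dom K V1 V2 φ

/-- `L ≤ L'` over the class `M`. -/
def Leq {AP : Type} (M : Set (KripkeTree AP)) (L L' : MLogic AP) : Prop :=
  ∀ φ : MSOL AP, φ.IsSentence → L.syn φ →
    ∃ φ' : MSOL AP, φ'.IsSentence ∧ L'.syn φ' ∧
      ∀ K ∈ M, (L.KSat K φ ↔ L'.KSat K φ')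

/-- `L < L'` over the class `M`. -/
def Lt {AP : Type} (M : Set (KripkeTree AP)) (L L' : MLogic AP) : Prop :=
  Leq M L L' ∧ ¬ Leq M L' L

/-- `L ≡ L'` over the class `M`. -/
def EquivExp {AP : Type} (M : Set (KripkeTree AP)) (L L' : MLogic AP) : Prop :=
  Leq M L L' ∧ Leq M L' L

/-- `L` and `L'` are expressively incomparable over the class `M`. -/
def Incomp {AP : Type} (M : Set (KripkeTree AP)) (L L' : MLogic AP) : Prop :=
  ¬ Leq M L L' ∧ ¬ Leq M L' L

end MLogic

/-! ## The concrete logics -/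

def MSOdom : SODom := fun T => {S | S ⊆ T}
def MTLdom : SODom := fun T => {S | S ⊆ T ∧ IsTree S}
def MPLdom : SODom := fun T => {S | IsPathOf T S}
def weakDom (D : SODom) : SODom := fun T => {S | S ∈ D T ∧ S.Finite}
def coweakDom (D : SODom) : SODom := fun T => {S | S ∈ D T ∧ S.Infinite}

def MSO (AP : Type) : MLogic AP := ⟨fun _ => True, MSOdom⟩
def MTL (AP : Type) : MLogic AP := ⟨fun _ => True, MTLdom⟩
def MPL (AP : Type) : MLogic AP := ⟨fun _ => True, MPLdom⟩
def WMSO (AP : Type) : MLogic AP := ⟨fun _ => True, weakDom MSOdom⟩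
def WMTL (AP : Type) : MLogic AP := ⟨fun _ => True, weakDom MTLdom⟩
def WMPL (AP : Type) : MLogic AP := ⟨fun _ => True, weakDom MPLdom⟩
def CoWMSO (AP : Type) : MLogic AP := ⟨fun _ => True, coweakDom MSOdom⟩
def CoWMTL (AP : Type) : MLogic AP := ⟨fun _ => True, coweakDom MTLdom⟩
def CoWMPL (AP : Type) : MLogic AP := ⟨fun _ => True, coweakDom MPLdom⟩
def FOL (AP : Type) : MLogic AP := ⟨MSOL.IsFO, MSOdom⟩

/-! ## Classes of Kripke trees -/

def allKT (AP : Type) : Set (KripkeTree AP) := Set.univ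
def finBrKT (AP : Type) : Set (KripkeTree AP) := {K | FinBranching K.T}
/-- Kripke trees whose underlying tree is an infinite chain
(every node has exactly one child). -/
def chainKT (AP : Type) : Set (KripkeTree AP) :=
  {K | ∀ τ ∈ K.T, ∃! τ' : Node, childIn K.T τ τ'}

theorem sat_congr {AP : Type} (D : SODom) (K : KripkeTree AP) (φ : MSOL AP) :
    ∀ (V1 V1' : ℕ → Node) (V2 V2' : ℕ → Set Node),
      (∀ x ∈ φ.freeFO, V1 x = V1' x) → (∀ X ∈ φ.freeSO, V2 X = V2' X) →
      (Sat D K V1 V2 φ ↔ Sat D K V1' V2' φ) := by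
  induction φ with
  | atom a x =>
    intro V1 V1' V2 V2' h1 h2
    simp only [Sat]; rw [h1 x (by simp [MSOL.freeFO])]
  | le x y =>
    intro V1 V1' V2 V2' h1 h2
    simp only [Sat]; rw [h1 x (by simp [MSOL.freeFO]), h1 y (by simp [MSOL.freeFO])]
  | mem x X =>
    intro V1 V1' V2 V2' h1 h2
    simp only [Sat]; rw [h1 x (by simp [MSOL.freeFO]), h2 X (by simp [MSOL.freeSO])]
  | not φ ih =>
    intro V1 V1' V2 V2' h1 h2
    simp only [Sat]; rw [ih V1 V1' V2 V2' h1 h2]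
  | and φ ψ ih1 ih2 =>
    intro V1 V1' V2 V2' h1 h2
    simp only [Sat]
    rw [ih1 V1 V1' V2 V2' (fun x hx => h1 x (Or.inl hx)) (fun x hx => h2 x (Or.inl hx)),
      ih2 V1 V1' V2 V2' (fun x hx => h1 x (Or.inr hx)) (fun x hx => h2 x (Or.inr hx))]
  | exFO x φ ih =>
    intro V1 V1' V2 V2' h1 h2
    simp only [Sat]
    refine exists_congr fun τ => and_congr_right fun _ => ih _ _ _ _ ?_ h2
    intro y hy
    by_cases hxy : y = x
    · subst hxy; simp
    · simp only [Function.update_of_ne hxy]; exact h1 y ⟨hy, hxy⟩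
  | exSO X φ ih =>
    intro V1 V1' V2 V2' h1 h2
    simp only [Sat]
    refine exists_congr fun τ => and_congr_right fun _ => ih _ _ _ _ h1 ?_
    intro y hy
    by_cases hxy : y = X
    · subst hxy; simp
    · simp only [Function.update_of_ne hxy]; exact h2 y ⟨hy, hxy⟩

theorem ksat_iff {AP : Type} (L : MLogic AP) (K : KripkeTree AP) (φ : MSOL AP)
    (h : φ.IsSentence) (V1 : ℕ → Node) (V2 : ℕ → Set Node) :
    L.KSat K φ ↔ Sat L.dom K V1 V2 φ := by
  constructor
  · rintro ⟨W1, W2, hW⟩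
    refine (sat_congr L.dom K φ W1 V1 W2 V2 ?_ ?_).1 hW
    · rw [h.1]; simp
    · rw [h.2]; simp
  · intro hV; exact ⟨V1, V2, hV⟩

def qr {AP : Type} : MSOL AP → ℕ
  | .atom _ _ => 0
  | .le _ _ => 0
  | .mem _ _ => 0
  | .not φ => qr φ
  | .and φ ψ => max (qr φ) (qr ψ)
  | .exFO _ φ => qr φ + 1
  | .exSO _ φ => qr φ + 1

theorem ef_game {AP : Type} (D : SODom) (K K' : KripkeTree AP)
    (hK : ∀ u, K.Lab u = ∅) (hK' : ∀ u, K'.Lab u = ∅)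
    (R : ℕ → (ℕ → Node) → (ℕ → Set Node) → (ℕ → Node) → (ℕ → Set Node) → Prop)
    (hle : ∀ k V1 V2 V1' V2', R k V1 V2 V1' V2' → ∀ x y,
      ((V1 x ∈ K.T ∧ V1 y ∈ K.T ∧ V1 x <+: V1 y) ↔ (V1' x ∈ K'.T ∧ V1' y ∈ K'.T ∧ V1' x <+: V1' y)))
    (hmem : ∀ k V1 V2 V1' V2', R k V1 V2 V1' V2' → ∀ x X, (V1 x ∈ V2 X ↔ V1' x ∈ V2' X))
    (hf1 : ∀ k V1 V2 V1' V2', R (k+1) V1 V2 V1' V2' → ∀ x, ∀ τ ∈ K.T, ∃ τ' ∈ K'.T,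
      R k (Function.update V1 x τ) V2 (Function.update V1' x τ') V2')
    (hb1 : ∀ k V1 V2 V1' V2', R (k+1) V1 V2 V1' V2' → ∀ x, ∀ τ' ∈ K'.T, ∃ τ ∈ K.T,
      R k (Function.update V1 x τ) V2 (Function.update V1' x τ') V2')
    (hf2 : ∀ k V1 V2 V1' V2', R (k+1) V1 V2 V1' V2' → ∀ x, ∀ S ∈ D K.T, ∃ S' ∈ D K'.T,
      R k V1 (Function.update V2 x S) V1' (Function.update V2' x S'))
    (hb2 : ∀ k V1 V2 V1' V2', R (k+1) V1 V2 V1' V2' → ∀ x, ∀ S' ∈ D K'.T, ∃ S ∈ D K.T,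
      R k V1 (Function.update V2 x S) V1' (Function.update V2' x S'))
    (φ : MSOL AP) : ∀ k V1 V2 V1' V2', qr φ ≤ k → R k V1 V2 V1' V2' →
      (Sat D K V1 V2 φ ↔ Sat D K' V1' V2' φ) := by
  induction φ with
  | atom a x => intro k V1 V2 V1' V2' _ _; simp [Sat, hK, hK']
  | le x y => intro k V1 V2 V1' V2' _ h; simp only [Sat]; exact hle _ _ _ _ _ h x y
  | mem x X => intro k V1 V2 V1' V2' _ h; simp only [Sat]; exact hmem _ _ _ _ _ h x X
  | not φ ih => intro k V1 V2 V1' V2' hq h; simp only [Sat]; rw [ih k V1 V2 V1' V2' hq h]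
  | and φ ψ ih1 ih2 =>
    intro k V1 V2 V1' V2' hq h; simp only [Sat]
    rw [ih1 k V1 V2 V1' V2' ((le_max_left _ _).trans hq) h,
      ih2 k V1 V2 V1' V2' ((le_max_right _ _).trans hq) h]
  | exFO x φ ih =>
    intro k V1 V2 V1' V2' hq h
    obtain ⟨k, rfl⟩ : ∃ j, k = j + 1 := ⟨k - 1, by simp only [qr] at hq; omega⟩
    simp only [qr, Nat.add_le_add_iff_right] at hq
    simp only [Sat]
    constructor
    · rintro ⟨τ, hτ, hs⟩
      obtain ⟨τ', hτ', hr⟩ := hf1 k _ _ _ _ h x τ hτ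
      exact ⟨τ', hτ', (ih k _ _ _ _ hq hr).1 hs⟩
    · rintro ⟨τ, hτ, hs⟩
      obtain ⟨τ', hτ', hr⟩ := hb1 k _ _ _ _ h x τ hτ
      exact ⟨τ', hτ', (ih k _ _ _ _ hq hr).2 hs⟩
  | exSO x φ ih =>
    intro k V1 V2 V1' V2' hq h
    obtain ⟨k, rfl⟩ : ∃ j, k = j + 1 := ⟨k - 1, by simp only [qr] at hq; omega⟩
    simp only [qr, Nat.add_le_add_iff_right] at hq
    simp only [Sat]
    constructor
    · rintro ⟨τ, hτ, hs⟩
      obtain ⟨τ', hτ', hr⟩ := hf2 k _ _ _ _ h x τ hτ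
      exact ⟨τ', hτ', (ih k _ _ _ _ hq hr).1 hs⟩
    · rintro ⟨τ, hτ, hs⟩
      obtain ⟨τ', hτ', hr⟩ := hb2 k _ _ _ _ h x τ hτ
      exact ⟨τ', hτ', (ih k _ _ _ _ hq hr).2 hs⟩

theorem isPath_imp {T P : Set Node} (h : IsPathOf T P) :
    P ⊆ T ∧ P.Nonempty ∧ (∀ σ ∈ P, ∀ τ ∈ P, σ <+: τ ∨ τ <+: σ) ∧
      (∀ σ ∈ P, ∀ τ ∈ P, ∀ ρ, σ <+: ρ → ρ <+: τ → ρ ∈ P) := by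
  obtain ⟨⟨hsub, r, hr, hext, hcl⟩, huniq⟩ := h
  have hconv : ∀ ρ, ∀ τ ∈ P, r <+: ρ → ρ <+: τ → ρ ∈ P := by
    rintro ρ τ hτ ⟨a, rfl⟩ ⟨b, rfl⟩
    rw [List.append_assoc] at hτ
    exact hcl _ _ hτ (List.prefix_append _ _)
  refine ⟨hsub, ⟨r, hr⟩, ?_, ?_⟩
  · intro σ hσ τ hτ
    obtain ⟨a, rfl⟩ := hext σ hσ
    obtain ⟨b, rfl⟩ := hext τ hτ
    have key : ∀ (a b c : List ℕ), r ++ (c ++ a) ∈ P → r ++ (c ++ b) ∈ P →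
        a <+: b ∨ b <+: a := by
      intro a
      induction a with
      | nil => intro b c _ _; left; exact List.nil_prefix
      | cons x a ih =>
        intro b c h1 h2
        cases b with
        | nil => right; exact List.nil_prefix
        | cons y b =>
          have e1 : r ++ (c ++ x :: a) = ((r ++ c) ++ [x]) ++ a := by simp
          have e2 : r ++ (c ++ y :: b) = ((r ++ c) ++ [y]) ++ b := by simp
          have m1 : (r ++ c) ++ [x] ∈ P := hconv _ _ h1 (by simp) (by rw [e1]; exact List.prefix_append _ _)
          have m2 : (r ++ c) ++ [y] ∈ P := hconv _ _ h2 (by simp) (by rw [e2]; exact List.prefix_append _ _)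
          have m0 : r ++ c ∈ P := hconv _ _ m1 (List.prefix_append _ _) (List.prefix_append _ _)
          have hxy := huniq _ m0 _ _ m1 m2
          subst hxy
          rcases ih b (c ++ [x]) (by simpa using h1) (by simpa using h2) with h | h
          · left; exact (List.prefix_cons_inj x).2 h
          · right; exact (List.prefix_cons_inj x).2 h
    rcases key a b [] (by simpa using hσ) (by simpa using hτ) with h | h
    · left; exact (List.prefix_append_right_inj r).2 h
    · right; exact (List.prefix_append_right_inj r).2 h
  · intro σ hσ τ hτ ρ h1 h2
    exact hconv ρ τ hτ ((hext σ hσ).trans h1) h2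

theorem isPath_of {T P : Set Node} (hsub : P ⊆ T) (hne : P.Nonempty)
    (hch : ∀ σ ∈ P, ∀ τ ∈ P, σ <+: τ ∨ τ <+: σ)
    (hconv : ∀ σ ∈ P, ∀ τ ∈ P, ∀ ρ, σ <+: ρ → ρ <+: τ → ρ ∈ P) : IsPathOf T P := by
  obtain ⟨r, hr, hmin⟩ : ∃ r ∈ P, ∀ τ ∈ P, r.length ≤ τ.length := by
    obtain ⟨r, hr, h⟩ := (InvImage.wf (fun u : Node => u.length) Nat.lt_wfRel.wf).has_min P hne
    exact ⟨r, hr, fun τ hτ => not_lt.1 (h τ hτ)⟩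
  refine ⟨⟨hsub, r, hr, ?_, ?_⟩, ?_⟩
  · intro τ hτ
    rcases hch r hr τ hτ with h | h
    · exact h
    · rw [h.eq_of_length (le_antisymm h.length_le (hmin τ hτ))]
  · intro σ σ' h1 h2
    exact hconv r hr _ h1 _ (List.prefix_append _ _) ((List.prefix_append_right_inj r).2 h2)
  · intro τ hτ n m hn hm
    have : τ ++ [n] = τ ++ [m] := by
      rcases hch _ hn _ hm with h | h
      · exact h.eq_of_length (by simp)
      · exact (h.eq_of_length (by simp)).symm
    simpa using this

theorem sat_measurable {AP X : Type} [MeasurableSpace X] (K : X → KripkeTree AP)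
    (D : SODom) (Q : Set Node → Prop)
    (hD : ∀ T S, S ∈ D T ↔ (S ⊆ T ∧ Q S ∧ S.Finite))
    (hlab : ∀ x u, (K x).Lab u = ∅)
    (hm : ∀ u, MeasurableSet {x | u ∈ (K x).T}) (φ : MSOL AP) :
    ∀ V1 V2, MeasurableSet {x | Sat D (K x) V1 V2 φ} := by
  induction φ with
  | atom a y => intro V1 V2; simp [Sat, hlab]
  | le y z =>
    intro V1 V2; simp only [Sat]
    exact (hm _).inter ((hm _).inter (MeasurableSet.const _))
  | mem y X => intro V1 V2; simp only [Sat]; exact MeasurableSet.const _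
  | not φ ih => intro V1 V2; simp only [Sat]; exact (ih V1 V2).compl
  | and φ ψ ih1 ih2 => intro V1 V2; simp only [Sat]; exact (ih1 V1 V2).inter (ih2 V1 V2)
  | exFO y φ ih =>
    intro V1 V2; simp only [Sat, Set.ofPred_exists]
    exact MeasurableSet.iUnion fun τ => (hm τ).inter (ih _ _)
  | exSO Y φ ih =>
    intro V1 V2; simp only [Sat, hD]
    have : {x | ∃ S, (S ⊆ (K x).T ∧ Q S ∧ S.Finite) ∧ Sat D (K x) V1 (Function.update V2 Y S) φ}
        = ⋃ S : Finset Node, ((⋂ u : Node, {x | u ∈ S → u ∈ (K x).T}) ∩ ({x | Q S} ∩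
          {x | Sat D (K x) V1 (Function.update V2 Y S) φ})) := by
      ext x
      simp only [Set.mem_ofPred_eq, Set.mem_iUnion, Set.mem_inter_iff, Set.mem_iInter]
      constructor
      · rintro ⟨S, ⟨h1, h2, h3⟩, h4⟩
        refine ⟨h3.toFinset, ?_, ?_, ?_⟩
        · intro u hu; exact h1 (by simpa using hu)
        · simpa using h2
        · simpa using h4
      · rintro ⟨S, h1, h2, h3⟩
        exact ⟨S, ⟨fun u hu => h1 u (by simpa using hu), h2, S.finite_toSet⟩, h3⟩
    rw [this]
    refine MeasurableSet.iUnion fun S => MeasurableSet.inter ?_ ((MeasurableSet.const _).inter (ih _ _))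
    refine MeasurableSet.iInter fun u => ?_
    exact (MeasurableSet.const (u ∈ S)).imp (hm u)

def pre (z : ℕ → Bool) (n : ℕ) : List Bool := (List.range n).map z

def Mark (x : ℕ → Bool) (l : List Bool) : Prop :=
  x (Encodable.encode (pre x l.length, l)) = true

def setA : Set (ℕ → Bool) := {x | ∃ z : ℕ → Bool, ∃ᶠ n in Filter.atTop, Mark x (pre z n)}

theorem pre_length (z : ℕ → Bool) (n : ℕ) : (pre z n).length = n := by simp [pre]

theorem pre_eq_iff (z z' : ℕ → Bool) (n : ℕ) : pre z n = pre z' n ↔ ∀ i < n, z i = z' i := by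
  simp [pre]

noncomputable def GG (z : ℕ → Bool) (k : ℕ) : ℕ := (Nat.nth (fun n => z n = false) k).unpair.1

theorem GG_local (z : ℕ → Bool) (hz : {n | z n = false}.Infinite) (k : ℕ) :
    ∃ m, ∀ z', (∀ i < m, z' i = z i) → GG z' k = GG z k := by
  refine ⟨Nat.nth (fun n => z n = false) k + 1, fun z' h => ?_⟩
  unfold GG
  congr 2
  set m := Nat.nth (fun n => z n = false) k with hm
  have h1 : z m = false := Nat.nth_mem_of_infinite hz k
  have h2 : z' m = false := by rw [h m (by omega), h1]
  have h3 : Nat.count (fun n => z' n = false) m = k := by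
    have : Nat.count (fun n => z n = false) m = k := Nat.count_nth_of_infinite hz k
    rw [← this, Nat.count_eq_card_filter_range, Nat.count_eq_card_filter_range]
    congr 1
    apply Finset.filter_congr
    intro i hi
    rw [h i (by have := Finset.mem_range.1 hi; omega)]
  have h4 := Nat.nth_count (p := fun n => z' n = false) h2
  rw [h3] at h4
  exact h4

theorem GG_cont (z : ℕ → Bool) (hz : {n | z n = false}.Infinite) (w : ℕ → ℕ → Bool)
    (hw : ∀ m, ∀ i < m, w m i = z i) :
    Filter.Tendsto (fun m => GG (w m)) Filter.atTop (nhds (GG z)) := by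
  rw [tendsto_pi_nhds]
  intro k
  obtain ⟨m, hm⟩ := GG_local z hz k
  refine tendsto_const_nhds.congr' ?_
  filter_upwards [Filter.eventually_ge_atTop m] with n hn
  exact (hm (w n) fun i hi => hw n i (by omega)).symm

theorem GG_surj (y : ℕ → ℕ) : ∃ z : ℕ → Bool, {n | z n = false}.Infinite ∧ GG z = y := by
  obtain ⟨p, hp, hy⟩ := Filter.extraction_forall_of_frequently
    (P := fun n k => k.unpair.1 = y n) (by
      intro n
      rw [Filter.frequently_atTop]
      intro a
      exact ⟨Nat.pair (y n) a, Nat.right_le_pair _ _, by simp⟩)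
  classical
  refine ⟨fun n => decide (n ∉ Set.range p), ?_, ?_⟩
  · have : {n | decide (n ∉ Set.range p) = false} = Set.range p := by ext n; simp
    rw [this]; exact Set.infinite_range_of_injective hp.injective
  · funext k
    unfold GG
    have : (fun n => decide (n ∉ Set.range p) = false) = (fun n => n ∈ Set.range p) := by
      funext n; simp
    rw [this, ← hy k]
    congr 2
    have hinf : (Set.ofPred fun n => n ∈ Set.range p).Infinite :=
      Set.infinite_range_of_injective hp.injective
    refine congrFun (((Nat.nth_strictMono hinf).range_inj hp).1 ?_) k
    rw [Nat.range_nth_of_infinite hinf]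
    rfl

theorem setA_not_measurable : ¬ MeasurableSet setA := by
  intro hA
  have : PolishSpace (ℕ → Bool) := {}
  have han := hA.compl.analyticSet
  rw [MeasureTheory.AnalyticSet] at han
  rcases han with h | ⟨f, hf, hr⟩
  · have : (fun _ => false) ∈ setAᶜ := by
      rintro ⟨z, hz⟩
      obtain ⟨n, hn⟩ := hz.exists
      simp [Mark] at hn
    rw [h] at this; exact this
  classical
  let P : List Bool × List Bool → Prop := fun q =>
    q.2.getLast? = some false ∧ ∃ z', pre z' q.2.length = q.2 ∧ pre (f (GG z')) q.2.length = q.1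
  let c : ℕ → Bool := fun n => match (Encodable.decode n : Option (List Bool × List Bool)) with
    | some q => decide (P q)
    | none => false
  have hc : ∀ l, Mark c l ↔ P (pre c l.length, l) := by
    intro l
    simp only [Mark]
    change (match (Encodable.decode (Encodable.encode (pre c l.length, l)) : Option (List Bool × List Bool)) with
    | some q => decide (P q)
    | none => false) = true ↔ _
    rw [Encodable.encodek]
    simp
  have hlast : ∀ (z : ℕ → Bool) n, (pre z (n+1)).getLast? = some (z n) := by
    intro z n; simp [pre, List.range_succ]
  by_cases hcA : c ∈ setA
  · have hcr : c ∈ Set.range f := by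
      obtain ⟨z, hz⟩ := hcA
      have hzinf : {n | z n = false}.Infinite := by
        rw [← Nat.frequently_atTop_iff_infinite, Filter.frequently_atTop]
        rw [Filter.frequently_atTop] at hz
        intro a
        obtain ⟨b, hb, hm⟩ := hz (a+1)
        rw [hc] at hm
        obtain ⟨b, rfl⟩ : ∃ j, b = j + 1 := ⟨b - 1, by omega⟩
        have := hm.1
        simp only [hlast] at this
        exact ⟨b, by omega, by simpa using this⟩
      refine ⟨GG z, ?_⟩
      have hch : ∀ m, ∃ w : ℕ → Bool, (∀ i < m, w i = z i) ∧ ∀ i < m, f (GG w) i = c i := by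
        intro m
        rw [Filter.frequently_atTop] at hz
        obtain ⟨b, hb, hm⟩ := hz m
        rw [hc] at hm
        obtain ⟨-, w, h1, h2⟩ := hm
        simp only [pre_length, pre_eq_iff] at h1 h2
        exact ⟨w, fun i hi => h1 i (by omega), fun i hi => h2 i (by omega)⟩
      choose w hw1 hw2 using hch
      have t1 := (hf.tendsto (GG z)).comp (GG_cont z hzinf w hw1)
      have t2 : Filter.Tendsto (f ∘ fun m => GG (w m)) Filter.atTop (nhds c) := by
        rw [tendsto_pi_nhds]
        intro k
        refine tendsto_const_nhds.congr' ?_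
        filter_upwards [Filter.eventually_gt_atTop k] with n hn
        exact (hw2 n k hn).symm
      exact tendsto_nhds_unique t1 t2
    rw [hr] at hcr
    exact hcr hcA
  · have hcr : c ∈ Set.range f := by rw [hr]; exact hcA
    obtain ⟨y, hy⟩ := hcr
    obtain ⟨z, hz, rfl⟩ := GG_surj y
    apply hcA
    refine ⟨z, ?_⟩
    rw [Filter.frequently_atTop]
    rw [← Nat.frequently_atTop_iff_infinite, Filter.frequently_atTop] at hz
    intro a
    obtain ⟨b, hb, hzb⟩ := hz a
    refine ⟨b + 1, by omega, ?_⟩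
    rw [hc]
    refine ⟨by simp only [hlast, hzb], z, by simp only [pre_length], by simp only [hy]⟩

theorem mark_measurable (l : List Bool) : MeasurableSet {x | Mark x l} := by
  have h1 : ∀ n (s : List Bool), MeasurableSet {x | pre x n = s} := by
    intro n s
    by_cases h : ∃ x0, pre x0 n = s
    · obtain ⟨x0, rfl⟩ := h
      simp only [pre_eq_iff]
      have : {x : ℕ → Bool | ∀ i < n, x i = x0 i} = ⋂ i, {x | i < n → x i = x0 i} := by
        ext x; simp
      rw [this]
      refine MeasurableSet.iInter fun i => (MeasurableSet.const _).imp ?_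
      exact measurableSet_eq_fun (measurable_pi_apply i) measurable_const
    · have : {x | pre x n = s} = ∅ := by
        ext x; simp only [Set.mem_ofPred_eq, Set.mem_empty_iff_false, iff_false]
        exact fun hx => h ⟨x, hx⟩
      rw [this]; exact MeasurableSet.empty
  have : {x | Mark x l} = ⋃ s : List Bool, ({x | pre x l.length = s} ∩
      {x | x (Encodable.encode (s, l)) = true}) := by
    ext x; simp [Mark]
  rw [this]
  refine MeasurableSet.iUnion fun s => (h1 _ _).inter ?_
  exact measurableSet_eq_fun (measurable_pi_apply _) measurable_const

def enc (l : List Bool) : Node := l.map Bool.toNat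

def btT (x : ℕ → Bool) : Set Node :=
  {u | ∃ l k, u = enc l ++ List.replicate k 2 ∧ (k = 0 ∨ Mark x l)}

theorem enc_inj {l l' : List Bool} (h : enc l = enc l') : l = l' :=
  List.map_injective_iff.2 (by intro a b; cases a <;> cases b <;> simp) h

theorem enc_prefix {l l' : List Bool} (h : enc l <+: enc l') : l <+: l' := by
  obtain ⟨t, ht⟩ := h
  unfold enc at ht
  obtain ⟨a, b, rfl, h1, h2⟩ := List.append_eq_map_iff.1 ht
  rw [enc_inj h1.symm]; exact List.prefix_append _ _

theorem prefix_enc {u : Node} {l : List Bool} (h : u <+: enc l) : ∃ l', l' <+: l ∧ u = enc l' := by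
  obtain ⟨t, ht⟩ := h
  unfold enc at ht
  obtain ⟨a, b, rfl, h1, h2⟩ := List.append_eq_map_iff.1 ht
  exact ⟨a, List.prefix_append _ _, h1.symm⟩

theorem prefix_app {u a b : Node} (h : u <+: a ++ b) : u <+: a ∨ ∃ t, t <+: b ∧ u = a ++ t := by
  obtain ⟨t, ht⟩ := h
  rcases List.append_eq_append_iff.1 ht with ⟨c, h1, h2⟩ | ⟨c, h1, h2⟩
  · left; exact ⟨c, h1.symm⟩
  · right; exact ⟨c, ⟨t, h2.symm⟩, h1⟩

theorem prefix_replicate {t : Node} {k a : ℕ} (h : t <+: List.replicate k a) :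
    ∃ j ≤ k, t = List.replicate j a := by
  refine ⟨t.length, by simpa using h.length_le, ?_⟩
  rw [List.eq_replicate_iff]
  refine ⟨rfl, fun b hb => ?_⟩
  exact List.eq_of_mem_replicate (h.subset hb)

theorem enc_ne2 (l : List Bool) : ∀ a ∈ enc l, a ≠ 2 := by
  intro a ha
  simp only [enc, List.mem_map] at ha
  obtain ⟨b, _, rfl⟩ := ha
  cases b <;> simp

theorem tw_enc (l : List Bool) (t : Node) :
    (enc l ++ 2 :: t).takeWhile (fun a => decide (a ≠ 2)) = enc l := by
  rw [List.takeWhile_append_of_pos]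
  · simp
  · intro a ha; simpa using enc_ne2 l a ha

theorem two_ext {l l' : List Bool} {k j : ℕ}
    (h : enc l ++ List.replicate (k+1) 2 <+: enc l' ++ List.replicate j 2) :
    l = l' ∧ k + 1 ≤ j := by
  rcases prefix_app h with h1 | ⟨t, h1, h2⟩
  · exfalso
    exact enc_ne2 l' 2 (h1.subset (by simp)) rfl
  · obtain ⟨i, hi, rfl⟩ := prefix_replicate h1
    cases i with
    | zero =>
      exfalso
      refine enc_ne2 l' 2 ?_ rfl
      have : enc l' = enc l ++ List.replicate (k+1) 2 := by rw [h2]; simp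
      rw [this]; simp
    | succ i =>
      have h3 := congrArg (List.takeWhile (fun a => decide (a ≠ 2))) h2
      rw [List.replicate_succ, List.replicate_succ, tw_enc, tw_enc] at h3
      refine ⟨enc_inj h3, ?_⟩
      rw [h3, List.append_cancel_left_eq] at h2
      have := congrArg List.length h2
      simp at this; omega

theorem enc_not_two {l l' : List Bool} {k : ℕ} (h : enc l ++ List.replicate k 2 <+: enc l') :
    k = 0 := by
  cases k with
  | zero => rfl
  | succ k => exact absurd rfl (enc_ne2 l' 2 (h.subset (by simp)))

theorem btT_prefix {x : ℕ → Bool} {u v : Node} (h : v ∈ btT x) (hu : u <+: v) : u ∈ btT x := by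
  obtain ⟨l, k, rfl, hk⟩ := h
  rcases prefix_app hu with h1 | ⟨t, h1, rfl⟩
  · obtain ⟨l', -, rfl⟩ := prefix_enc h1
    exact ⟨l', 0, by simp, Or.inl rfl⟩
  · obtain ⟨j, hj, rfl⟩ := prefix_replicate h1
    refine ⟨l, j, rfl, ?_⟩
    rcases hk with rfl | hk
    · left; omega
    · right; exact hk

theorem enc_mem (x : ℕ → Bool) (l : List Bool) : enc l ∈ btT x := ⟨l, 0, by simp, Or.inl rfl⟩

def KB (AP : Type) (x : ℕ → Bool) : KripkeTree AP where
  T := btT x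
  root := []
  rooted := by
    refine ⟨enc_mem x [], fun τ _ => List.nil_prefix, ?_⟩
    intro σ σ' h h'
    exact btT_prefix h (by simpa using h')
  nonblocking := by
    rintro τ ⟨l, k, rfl, hk⟩
    cases k with
    | zero => exact ⟨0, by have := enc_mem x (l ++ [false]); simpa [enc] using this⟩
    | succ k =>
      refine ⟨2, l, k + 2, ?_, Or.inr (by simpa using hk)⟩
      rw [List.replicate_succ' (n := k+1)]; simp
  Lab := fun _ => ∅

theorem KB_fin (AP : Type) (x : ℕ → Bool) : KB AP x ∈ finBrKT AP := by
  intro τ _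
  refine Set.Finite.subset (s := {τ ++ [0], τ ++ [1], τ ++ [2]}) (by simp) ?_
  rintro τ' ⟨⟨l, k, h, -⟩, n, rfl⟩
  have hn : n ∈ enc l ++ List.replicate k 2 := by rw [← h]; simp
  rw [List.mem_append] at hn
  rcases hn with hn | hn
  · simp only [enc, List.mem_map] at hn
    obtain ⟨b, _, rfl⟩ := hn
    cases b <;> simp
  · rw [List.eq_of_mem_replicate hn]; simp

theorem KB_meas (AP : Type) (u : Node) : MeasurableSet {x | u ∈ (KB AP x).T} := by
  have : {x | u ∈ (KB AP x).T} = ⋃ l : List Bool, ⋃ k : ℕ,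
      ({x : ℕ → Bool | u = enc l ++ List.replicate k 2} ∩ ({x | k = 0} ∪ {x | Mark x l})) := by
    ext x; simp [KB, btT]
  rw [this]
  refine MeasurableSet.iUnion fun l => MeasurableSet.iUnion fun k => ?_
  exact (MeasurableSet.const _).inter ((MeasurableSet.const _).union (mark_measurable l))

def fLt {AP : Type} (a b : ℕ) : MSOL AP := .and (.le a b) (.not (.le b a))
def fChain {AP : Type} (d u v : ℕ) : MSOL AP :=
  .not (.exFO u (.exFO v (.and (.and (.le d u) (.le d v)) (.and (.not (.le u v)) (.not (.le v u))))))

def phiB (AP : Type) : MSOL AP :=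
  .exSO 0 (.not (.exFO 0 (.and (.mem 0 0) (.not (.exFO 1 (.and (.and (.mem 1 0) (fLt 0 1))
    (.and (.not (fChain 1 4 5)) (.exFO 2 (.and (fLt 1 2)
      (.and (.not (.exFO 3 (.and (fLt 1 3) (fLt 3 2)))) (fChain 2 4 5)))))))))))

theorem phiB_sentence (AP : Type) : (phiB AP).IsSentence := by
  constructor
  · ext n
    simp only [phiB, fLt, fChain, MSOL.freeFO, Set.mem_sdiff, Set.mem_union, Set.mem_insert_iff, Set.mem_singleton_iff, Set.mem_empty_iff_false, iff_false]
    tauto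
  · ext n
    simp only [phiB, fLt, fChain, MSOL.freeSO, Set.mem_sdiff, Set.mem_union, Set.mem_singleton_iff, Set.mem_empty_iff_false, iff_false]
    tauto

def SLt (T : Set Node) (a b : Node) : Prop := (a ∈ T ∧ b ∈ T ∧ a <+: b) ∧ ¬ (b ∈ T ∧ a ∈ T ∧ b <+: a)
def SChain (T : Set Node) (d : Node) : Prop :=
  ¬ ∃ u ∈ T, ∃ v ∈ T, ((d ∈ T ∧ u ∈ T ∧ d <+: u) ∧ (d ∈ T ∧ v ∈ T ∧ d <+: v)) ∧
    (¬ (u ∈ T ∧ v ∈ T ∧ u <+: v) ∧ ¬ (v ∈ T ∧ u ∈ T ∧ v <+: u))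

theorem phiB_sem (AP : Type) (K : KripkeTree AP) : (MPL AP).KSat K (phiB AP) ↔
    ∃ S, IsPathOf K.T S ∧ ¬ ∃ a ∈ K.T, a ∈ S ∧ ¬ ∃ b ∈ K.T, (b ∈ S ∧ SLt K.T a b) ∧
      (¬ SChain K.T b ∧ ∃ d ∈ K.T, SLt K.T b d ∧ (¬ ∃ e ∈ K.T, SLt K.T b e ∧ SLt K.T e d) ∧
        SChain K.T d) := by
  rw [ksat_iff _ _ _ (phiB_sentence AP) (fun _ => []) (fun _ => ∅)]
  simp only [phiB, fLt, fChain, Sat, MPL, MPLdom, SLt, SChain]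
  simp [Function.update]

theorem SLt_iff {T : Set Node} {a b : Node} (ha : a ∈ T) (hb : b ∈ T) :
    SLt T a b ↔ a <+: b ∧ a ≠ b := by
  simp only [SLt, ha, hb, true_and]
  constructor
  · rintro ⟨h1, h2⟩; exact ⟨h1, fun h => h2 (h ▸ List.prefix_refl _)⟩
  · rintro ⟨h1, h2⟩
    exact ⟨h1, fun h => h2 (h1.eq_of_length (le_antisymm h1.length_le h.length_le))⟩

theorem chain_enc (x : ℕ → Bool) (l : List Bool) : ¬ SChain (btT x) (enc l) := by
  intro h
  apply h
  refine ⟨enc (l ++ [false]), enc_mem x _, enc (l ++ [true]), enc_mem x _,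
    ⟨⟨enc_mem x _, enc_mem x _, ?_⟩, enc_mem x _, enc_mem x _, ?_⟩, ?_, ?_⟩
  · simp [enc]
  · simp [enc]
  · rintro ⟨-, -, h⟩
    have := enc_inj (h.eq_of_length (by simp [enc])); simp at this
  · rintro ⟨-, -, h⟩
    have := enc_inj (h.eq_of_length (by simp [enc])); simp at this

theorem chain_two (x : ℕ → Bool) (l : List Bool) (k : ℕ) :
    SChain (btT x) (enc l ++ List.replicate (k+1) 2) := by
  rintro ⟨u, hu, v, hv, ⟨⟨-, -, h1⟩, -, -, h2⟩, h3, h4⟩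
  have hu' := hu
  have hv' := hv
  obtain ⟨lu, ku, rfl, -⟩ := hu
  obtain ⟨lv, kv, rfl, -⟩ := hv
  obtain ⟨rfl, -⟩ := two_ext h1
  obtain ⟨rfl, -⟩ := two_ext h2
  rcases le_total ku kv with h | h
  · apply h3
    refine ⟨hu', hv', (List.prefix_append_right_inj _).2 ?_⟩
    obtain ⟨m, rfl⟩ := Nat.exists_eq_add_of_le h
    rw [List.replicate_add]; exact List.prefix_append _ _
  · apply h4
    refine ⟨hv', hu', (List.prefix_append_right_inj _).2 ?_⟩
    obtain ⟨m, rfl⟩ := Nat.exists_eq_add_of_le h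
    rw [List.replicate_add]; exact List.prefix_append _ _

theorem marked_iff (x : ℕ → Bool) (b : Node) (hb : b ∈ btT x) :
    (¬ SChain (btT x) b ∧ ∃ d ∈ btT x, SLt (btT x) b d ∧
      (¬ ∃ e ∈ btT x, SLt (btT x) b e ∧ SLt (btT x) e d) ∧ SChain (btT x) d) ↔
    ∃ l, b = enc l ∧ Mark x l := by
  constructor
  · rintro ⟨h1, d, hd, h2, h3, h4⟩
    have hd' := hd
    have hb' := hb
    obtain ⟨l, k, rfl, hk⟩ := hd
    obtain ⟨lb, kb, rfl, hkb⟩ := hb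
    cases kb with
    | succ kb => exact absurd (chain_two x _ _) h1
    | zero =>
    cases k with
    | zero => exact absurd h4 (by simpa using chain_enc x l)
    | succ k =>
    simp only [List.replicate_zero, List.append_nil] at *
    refine ⟨l, ?_, by simpa using hk⟩
    rw [SLt_iff hb' hd'] at h2
    by_contra hne
    apply h3
    refine ⟨enc l, enc_mem x l, ?_, ?_⟩
    · rw [SLt_iff hb' (enc_mem x l)]
      refine ⟨?_, hne⟩
      rcases prefix_app h2.1 with h | ⟨t, ht, h⟩
      · exact h
      · obtain ⟨j, -, rfl⟩ := prefix_replicate ht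
        have := enc_not_two (l := l) (l' := lb) (k := j) (h ▸ List.prefix_refl _)
        subst this
        rw [h]; simp
    · rw [SLt_iff (enc_mem x l) hd']
      exact ⟨List.prefix_append _ _, by simp⟩
  · rintro ⟨l, rfl, hm⟩
    have hd : enc l ++ List.replicate 1 2 ∈ btT x := ⟨l, 1, rfl, Or.inr hm⟩
    refine ⟨chain_enc x l, enc l ++ List.replicate 1 2, hd, ?_, ?_, chain_two x l 0⟩
    · rw [SLt_iff hb hd]; simp
    · rintro ⟨e, he, h1, h2⟩
      rw [SLt_iff hb he] at h1
      rw [SLt_iff he hd] at h2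
      have l1 := h1.1.length_le
      have l2 := h2.1.length_le
      have l3 : (enc l).length ≠ e.length := fun h => h1.2 (h1.1.eq_of_length h)
      have l4 : e.length ≠ _ := fun h => h2.2 (h2.1.eq_of_length h)
      simp only [List.length_append, List.length_replicate] at l2 l4
      omega

theorem pre_prefix (z : ℕ → Bool) {l : List Bool} {n : ℕ} (h : l <+: pre z n) :
    l = pre z l.length := by
  have hn : l.length ≤ n := by simpa [pre] using h.length_le
  rw [List.prefix_iff_eq_take] at h
  conv_lhs => rw [h]
  simp [pre, ← List.map_take, List.take_range, hn]

theorem phiB_KB (AP : Type) (x : ℕ → Bool) : (MPL AP).KSat (KB AP x) (phiB AP) ↔ x ∈ setA := by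
  rw [phiB_sem]
  change (∃ S, IsPathOf (btT x) S ∧ ¬ ∃ a ∈ btT x, a ∈ S ∧ ¬ ∃ b ∈ btT x, (b ∈ S ∧ SLt (btT x) a b) ∧ _) ↔ _
  constructor
  · rintro ⟨S, hS, hS2⟩
    obtain ⟨hsub, ⟨r, hr⟩, hch, hconv⟩ := isPath_imp hS
    have step : ∀ a ∈ S, ∃ l, enc l ∈ S ∧ Mark x l ∧ a <+: enc l ∧ a ≠ enc l := by
      intro a ha
      by_contra hcon
      apply hS2
      refine ⟨a, hsub ha, ha, ?_⟩
      rintro ⟨b, hb, ⟨hbS, hlt⟩, hm⟩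
      obtain ⟨l, rfl, hl⟩ := (marked_iff x b hb).1 hm
      exact hcon ⟨l, hbS, hl, (SLt_iff (hsub ha) hb).1 hlt⟩
    have hlong : ∀ n : ℕ, ∃ l, enc l ∈ S ∧ Mark x l ∧ n ≤ l.length := by
      intro n
      induction n with
      | zero => obtain ⟨l, h1, h2, -⟩ := step r hr; exact ⟨l, h1, h2, by omega⟩
      | succ n ih =>
        obtain ⟨l, h1, h2, h3⟩ := ih
        obtain ⟨l', h1', h2', h3', h4'⟩ := step _ h1
        refine ⟨l', h1', h2', ?_⟩
        have e1 := h3'.length_le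
        have e2 : (enc l).length ≠ (enc l').length := fun h => h4' (h3'.eq_of_length h)
        simp only [enc, List.length_map] at e1 e2
        omega
    choose L hL1 hL2 hL3 using fun n => hlong (n+1)
    refine ⟨fun i => (L i)[i]'(hL3 i), ?_⟩
    have hpre : ∀ l, enc l ∈ S → pre (fun i => (L i)[i]'(hL3 i)) l.length = l := by
      intro l hl
      apply List.ext_getElem
      · simp [pre]
      · intro i h1 h2
        simp only [pre, List.getElem_map, List.getElem_range]
        rcases hch _ (hL1 i) _ hl with h | h
        · exact (enc_prefix h).getElem _
        · exact ((enc_prefix h).getElem _).symm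
    rw [Filter.frequently_atTop]
    intro a
    refine ⟨(L a).length, by have := hL3 a; omega, ?_⟩
    rw [hpre _ (hL1 a)]; exact hL2 a
  · rintro ⟨z, hz⟩
    refine ⟨Set.range fun n => enc (pre z n), ?_, ?_⟩
    · have hmono : ∀ n m, n ≤ m → enc (pre z n) <+: enc (pre z m) := by
        intro n m h
        obtain ⟨c, rfl⟩ := Nat.exists_eq_add_of_le h
        simp only [enc, pre, List.range_add, List.map_append]
        exact List.prefix_append _ _
      apply isPath_of
      · rintro _ ⟨n, rfl⟩; exact enc_mem x _
      · exact ⟨_, 0, rfl⟩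
      · rintro _ ⟨n, rfl⟩ _ ⟨m, rfl⟩
        rcases le_total n m with h | h
        · left; exact hmono _ _ h
        · right; exact hmono _ _ h
      · rintro _ _ _ ⟨m, rfl⟩ ρ - h
        obtain ⟨l, hl, rfl⟩ := prefix_enc h
        exact ⟨l.length, by simp only; rw [← pre_prefix z hl]⟩
    · rintro ⟨a, ha, ⟨n, rfl⟩, h⟩
      apply h
      rw [Filter.frequently_atTop] at hz
      obtain ⟨m, hm, hmk⟩ := hz (n+1)
      refine ⟨enc (pre z m), enc_mem x _, ⟨⟨m, rfl⟩, ?_⟩, (marked_iff x _ (enc_mem x _)).2 ⟨_, rfl, hmk⟩⟩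
      rw [SLt_iff ha (enc_mem x _)]
      constructor
      · obtain ⟨c, rfl⟩ := Nat.exists_eq_add_of_le (show n ≤ m by omega)
        simp only [enc, pre, List.range_add, List.map_append]
        exact List.prefix_append _ _
      · intro h
        have := congrArg List.length h
        simp [enc, pre] at this; omega

theorem MPL_not_weak (AP : Type) (L : MLogic AP) (Q : Set Node → Prop)
    (hD : ∀ T S, S ∈ L.dom T ↔ (S ⊆ T ∧ Q S ∧ S.Finite)) :
    ¬ MLogic.Leq (finBrKT AP) (MPL AP) L := by
  intro h
  obtain ⟨φ, hs, -, hφ⟩ := h (phiB AP) (phiB_sentence AP) trivial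
  apply setA_not_measurable
  have := sat_measurable (KB AP) L.dom Q hD (fun _ _ => rfl) (KB_meas AP) φ (fun _ => []) (fun _ => ∅)
  convert this using 1
  ext x
  rw [Set.mem_ofPred_eq, ← ksat_iff L _ φ hs, ← hφ _ (KB_fin AP x), phiB_KB]

theorem Leq_mono {AP : Type} (L L' : MLogic AP) (h : ¬ MLogic.Leq (finBrKT AP) L L') :
    ¬ MLogic.Leq (allKT AP) L L' := by
  intro h'
  apply h
  intro φ h1 h2
  obtain ⟨φ', a, b, c⟩ := h' φ h1 h2
  exact ⟨φ', a, b, fun K _ => c K trivial⟩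

def sp (P : ℕ → Prop) : Set Node := {u | u = [] ∨ ∃ m j, P m ∧ u = m :: List.replicate j 0}

def KS (AP : Type) (P : ℕ → Prop) (hP : ∃ m, P m) : KripkeTree AP where
  T := sp P
  root := []
  rooted := by
    refine ⟨Or.inl rfl, fun τ _ => List.nil_prefix, ?_⟩
    intro σ σ' h h'
    simp only [List.nil_append] at *
    rcases h with rfl | ⟨m, j, hm, rfl⟩
    · left; simpa using h'
    · cases σ' with
      | nil => left; rfl
      | cons a t =>
        rw [List.cons_prefix_cons] at h'
        obtain ⟨rfl, h'⟩ := h'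
        obtain ⟨i, -, rfl⟩ := prefix_replicate h'
        exact Or.inr ⟨a, i, hm, rfl⟩
  nonblocking := by
    rintro τ (rfl | ⟨m, j, hm, rfl⟩)
    · obtain ⟨m, hm⟩ := hP
      exact ⟨m, Or.inr ⟨m, 0, hm, rfl⟩⟩
    · exact ⟨0, Or.inr ⟨m, j + 1, hm, by rw [List.replicate_succ']; simp⟩⟩
  Lab := fun _ => ∅

def phiS (AP : Type) : MSOL AP :=
  .exSO 0 (.not (.exFO 0 (.and (.not (.exFO 1 (.exFO 2 (.and (fLt 1 2) (fLt 2 0)))))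
    (.not (.mem 0 0)))))

theorem phiS_sentence (AP : Type) : (phiS AP).IsSentence := by
  constructor
  · ext n
    simp only [phiS, fLt, MSOL.freeFO, Set.mem_sdiff, Set.mem_union, Set.mem_insert_iff, Set.mem_singleton_iff, Set.mem_empty_iff_false, iff_false]
    tauto
  · ext n
    simp only [phiS, fLt, MSOL.freeSO, Set.mem_sdiff, Set.mem_union, Set.mem_singleton_iff, Set.mem_empty_iff_false, iff_false]
    tauto

theorem phiS_sem (AP : Type) (K : KripkeTree AP) : (WMTL AP).KSat K (phiS AP) ↔
    ∃ S, ((S ⊆ K.T ∧ IsTree S) ∧ S.Finite) ∧ ¬ ∃ a ∈ K.T,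
      (¬ ∃ b ∈ K.T, ∃ c ∈ K.T, SLt K.T b c ∧ SLt K.T c a) ∧ a ∉ S := by
  rw [ksat_iff _ _ _ (phiS_sentence AP) (fun _ => []) (fun _ => ∅)]
  simp only [phiS, fLt, Sat, WMTL, weakDom, MTLdom, SLt]
  simp [Function.update]

theorem SLt_len {T : Set Node} {a b : Node} (h : SLt T a b) : a.length < b.length := by
  have h1 := (SLt_iff h.1.1 h.1.2.1).1 h
  exact lt_of_le_of_ne h1.1.length_le fun e => h1.2 (h1.1.eq_of_length e)

theorem phiS_inf (AP : Type) : ¬ (WMTL AP).KSat (KS AP (fun _ => True) ⟨0, trivial⟩) (phiS AP) := by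
  rw [phiS_sem]
  rintro ⟨S, ⟨-, hfin⟩, h⟩
  have hmem : ∀ m : ℕ, [m] ∈ S := by
    intro m
    by_contra hm
    apply h
    refine ⟨[m], Or.inr ⟨m, 0, trivial, rfl⟩, ?_, hm⟩
    rintro ⟨b, -, c, -, h1, h2⟩
    have := SLt_len h1
    have := SLt_len h2
    simp only [List.length_cons, List.length_nil] at this; omega
  have : (Set.range fun m : ℕ => [m]).Infinite :=
    Set.infinite_range_of_injective (fun a b h => by simpa using h)
  exact this (hfin.subset (by rintro _ ⟨m, rfl⟩; exact hmem m))

theorem phiS_fin (AP : Type) (N : ℕ) (hN : ∃ m, m < N) :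
    (WMTL AP).KSat (KS AP (fun m => m < N) hN) (phiS AP) := by
  rw [phiS_sem]
  refine ⟨{u | u = [] ∨ ∃ m < N, u = [m]}, ⟨⟨?_, ?_⟩, ?_⟩, ?_⟩
  · rintro u (rfl | ⟨m, hm, rfl⟩)
    · exact Or.inl rfl
    · exact Or.inr ⟨m, 0, hm, rfl⟩
  · refine ⟨[], Or.inl rfl, fun _ _ => List.nil_prefix, ?_⟩
    intro σ σ' h h'
    simp only [List.nil_append] at *
    rcases h with rfl | ⟨m, hm, rfl⟩
    · left; simpa using h'
    · cases σ' with
      | nil => left; rfl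
      | cons a t =>
        rw [List.cons_prefix_cons] at h'
        obtain ⟨rfl, h'⟩ := h'
        have : t = [] := by simpa using h'
        subst this
        exact Or.inr ⟨a, hm, rfl⟩
  · refine Set.Finite.subset (s := insert [] ((fun m => [m]) '' Set.Iio N))
      (((Set.finite_Iio N).image _).insert _) ?_
    rintro u (rfl | ⟨m, hm, rfl⟩)
    · simp
    · right; exact ⟨m, hm, rfl⟩
  · rintro ⟨a, ha, h1, h2⟩
    have ha' := ha
    rcases ha with rfl | ⟨m, j, hm, rfl⟩
    · exact h2 (Or.inl rfl)
    · cases j with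
      | zero => exact h2 (Or.inr ⟨m, hm, rfl⟩)
      | succ j =>
        apply h1
        have m0 : ([] : Node) ∈ (KS AP (fun m => m < N) hN).T := Or.inl rfl
        have m1 : ([m] : Node) ∈ (KS AP (fun m => m < N) hN).T := Or.inr ⟨m, 0, hm, rfl⟩
        refine ⟨[], m0, [m], m1, ?_, ?_⟩
        · rw [SLt_iff m0 m1]; simp
        · rw [SLt_iff m1 ha']; simp [List.replicate_succ]

def gp (π : Equiv.Perm ℕ) : Node → Node
  | [] => []
  | m :: t => π m :: t

theorem gp_inv (π : Equiv.Perm ℕ) (u : Node) : gp π (gp π⁻¹ u) = u := by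
  cases u <;> simp [gp]

theorem gp_inv' (π : Equiv.Perm ℕ) (u : Node) : gp π⁻¹ (gp π u) = u := by
  cases u <;> simp [gp]

theorem gp_prefix (π : Equiv.Perm ℕ) (u v : Node) : gp π u <+: gp π v ↔ u <+: v := by
  cases u <;> cases v <;> simp [gp, List.cons_prefix_cons]

theorem gp_inj (π : Equiv.Perm ℕ) : Function.Injective (gp π) :=
  Function.LeftInverse.injective (gp_inv' π)

theorem gp_sp (π : Equiv.Perm ℕ) {P Q : ℕ → Prop} (h : ∀ m, P m → Q (π m)) {u : Node}
    (hu : u ∈ sp P) : gp π u ∈ sp Q := by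
  rcases hu with rfl | ⟨m, j, hm, rfl⟩
  · exact Or.inl rfl
  · exact Or.inr ⟨π m, j, h m hm, rfl⟩

theorem gp_congr {π π' : Equiv.Perm ℕ} {P : ℕ → Prop} (h : ∀ m, P m → π m = π' m) {u : Node}
    (hu : u ∈ sp P) : gp π u = gp π' u := by
  rcases hu with rfl | ⟨m, j, hm, rfl⟩
  · rfl
  · simp [gp, h m hm]

theorem sp_mono {P Q : ℕ → Prop} (h : ∀ m, P m → Q m) : sp P ⊆ sp Q := by
  rintro u (rfl | ⟨m, j, hm, rfl⟩)
  · exact Or.inl rfl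
  · exact Or.inr ⟨m, j, h m hm, rfl⟩

theorem gp_path (π : Equiv.Perm ℕ) {T T' S : Set Node} (hS : IsPathOf T S)
    (hsub : gp π '' S ⊆ T') : IsPathOf T' (gp π '' S) := by
  obtain ⟨-, hne, hch, hconv⟩ := isPath_imp hS
  refine isPath_of hsub (hne.image _) ?_ ?_
  · rintro _ ⟨a, ha, rfl⟩ _ ⟨b, hb, rfl⟩
    rw [gp_prefix, gp_prefix]; exact hch a ha b hb
  · rintro _ ⟨a, ha, rfl⟩ _ ⟨b, hb, rfl⟩ ρ h1 h2
    refine ⟨gp π⁻¹ ρ, ?_, gp_inv π ρ⟩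
    rw [← gp_inv π ρ, gp_prefix] at h1 h2
    exact hconv a ha b hb _ h1 h2

theorem sp_path {P : ℕ → Prop} {S : Set Node} (hS : IsPathOf (sp P) S) (m0 : ℕ) (hm0 : P m0) :
    ∃ m, P m ∧ S ⊆ sp (fun a => a = m) := by
  obtain ⟨hsub, -, hch, -⟩ := isPath_imp hS
  by_cases h : ∃ m j, P m ∧ (m :: List.replicate j 0) ∈ S
  · obtain ⟨m, j, hm, hmS⟩ := h
    refine ⟨m, hm, fun u hu => ?_⟩
    rcases hsub hu with rfl | ⟨m', j', hm', rfl⟩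
    · exact Or.inl rfl
    · refine Or.inr ⟨m', j', ?_, rfl⟩
      rcases hch _ hmS _ hu with h | h
      · exact ((List.cons_prefix_cons.1 h).1).symm
      · exact (List.cons_prefix_cons.1 h).1
  · refine ⟨m0, hm0, fun u hu => ?_⟩
    rcases hsub hu with rfl | ⟨m', j', hm', rfl⟩
    · exact Or.inl rfl
    · exact absurd ⟨m', j', hm', hu⟩ h

def RS (N k : ℕ) (V1 : ℕ → Node) (V2 : ℕ → Set Node) (V1' : ℕ → Node) (V2' : ℕ → Set Node) : Prop :=
  ∃ (π : Equiv.Perm ℕ) (L : Finset ℕ), L.card + k ≤ N ∧ (∀ m ∈ L, π m < N) ∧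
    (∀ x, V1 x ∈ sp (fun m => m ∈ L) ∧ V1' x = gp π (V1 x)) ∧
    (∀ X, V2 X ⊆ sp (fun m => m ∈ L) ∧ V2' X = gp π '' V2 X)

def RSx (N k : ℕ) (π : Equiv.Perm ℕ) (L : Finset ℕ) (V1 : ℕ → Node) (V2 : ℕ → Set Node) (V1' : ℕ → Node)
    (V2' : ℕ → Set Node) : Prop :=
  L.card + k ≤ N ∧ (∀ m ∈ L, π m < N) ∧
    (∀ x, V1 x ∈ sp (fun m => m ∈ L) ∧ V1' x = gp π (V1 x)) ∧
    (∀ X, V2 X ⊆ sp (fun m => m ∈ L) ∧ V2' X = gp π '' V2 X)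

theorem RS_ext {N k : ℕ} {π π' : Equiv.Perm ℕ} {L : Finset ℕ} {V1 : ℕ → Node} {V2 : ℕ → Set Node}
    {V1' : ℕ → Node} {V2' : ℕ → Set Node} (h : RSx N (k+1) π L V1 V2 V1' V2') (m : ℕ)
    (hm : π' m < N) (hag : ∀ a ∈ L, π' a = π a) : RSx N k π' (insert m L) V1 V2 V1' V2' := by
  obtain ⟨h1, h2, h3, h4⟩ := h
  have hsub : sp (fun m => m ∈ L) ⊆ sp (fun a => a ∈ insert m L) :=
    sp_mono fun a ha => Finset.mem_insert_of_mem ha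
  have hgp : ∀ u ∈ sp (fun m => m ∈ L), gp π u = gp π' u :=
    fun u hu => gp_congr (fun a ha => (hag a ha).symm) hu
  refine ⟨?_, ?_, ?_, ?_⟩
  · have := Finset.card_insert_le m L; omega
  · intro a ha
    rcases Finset.mem_insert.1 ha with rfl | ha
    · exact hm
    · rw [hag a ha]; exact h2 a ha
  · intro x
    exact ⟨hsub (h3 x).1, by rw [(h3 x).2, hgp _ (h3 x).1]⟩
  · intro X
    refine ⟨(h4 X).1.trans hsub, ?_⟩
    rw [(h4 X).2]
    exact Set.image_congr fun u hu => hgp u ((h4 X).1 hu)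

theorem RS_forth {N k : ℕ} {V1 : ℕ → Node} {V2 : ℕ → Set Node}
    {V1' : ℕ → Node} {V2' : ℕ → Set Node} (h : RS N (k+1) V1 V2 V1' V2') (m : ℕ) :
    ∃ π L, m ∈ L ∧ RSx N k π L V1 V2 V1' V2' := by
  obtain ⟨π, L, h⟩ := h
  by_cases hm : m ∈ L
  · exact ⟨π, insert m L, Finset.mem_insert_self _ _, RS_ext h m (h.2.1 m hm) fun _ _ => rfl⟩
  · obtain ⟨q, hq, hqL⟩ : ∃ q ∈ Finset.range N, q ∉ L.image π := by
      apply Finset.exists_mem_notMem_of_card_lt_card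
      have := h.1
      have := Finset.card_image_le (s := L) (f := π)
      simp; omega
    refine ⟨Equiv.swap (π m) q * π, insert m L, Finset.mem_insert_self _ _, RS_ext h m ?_ ?_⟩
    · simpa using hq
    · intro a ha
      simp only [Equiv.Perm.coe_mul, Function.comp_apply]
      apply Equiv.swap_apply_of_ne_of_ne
      · intro e; exact hm (π.injective e ▸ ha)
      · intro e; exact hqL (Finset.mem_image.2 ⟨a, ha, e⟩)

theorem RS_back {N k : ℕ} {V1 : ℕ → Node} {V2 : ℕ → Set Node}
    {V1' : ℕ → Node} {V2' : ℕ → Set Node} (h : RS N (k+1) V1 V2 V1' V2') (m : ℕ) (hm : m < N) :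
    ∃ π L, π⁻¹ m ∈ L ∧ RSx N k π L V1 V2 V1' V2' := by
  obtain ⟨π, L, h⟩ := h
  exact ⟨π, insert (π⁻¹ m) L, Finset.mem_insert_self _ _, RS_ext h _ (by simpa using hm) fun _ _ => rfl⟩

theorem RSx_upd1 {N k : ℕ} {π : Equiv.Perm ℕ} {L : Finset ℕ} {V1 : ℕ → Node} {V2 : ℕ → Set Node}
    {V1' : ℕ → Node} {V2' : ℕ → Set Node} (h : RSx N k π L V1 V2 V1' V2') (x : ℕ) (τ : Node)
    (hτ : τ ∈ sp (fun m => m ∈ L)) :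
    RS N k (Function.update V1 x τ) V2 (Function.update V1' x (gp π τ)) V2' := by
  refine ⟨π, L, h.1, h.2.1, fun y => ?_, h.2.2.2⟩
  by_cases hy : y = x
  · subst hy; simpa using hτ
  · simpa [Function.update_of_ne hy] using h.2.2.1 y

theorem RSx_upd2 {N k : ℕ} {π : Equiv.Perm ℕ} {L : Finset ℕ} {V1 : ℕ → Node} {V2 : ℕ → Set Node}
    {V1' : ℕ → Node} {V2' : ℕ → Set Node} (h : RSx N k π L V1 V2 V1' V2') (x : ℕ) (S : Set Node)
    (hS : S ⊆ sp (fun m => m ∈ L)) :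
    RS N k V1 (Function.update V2 x S) V1' (Function.update V2' x (gp π '' S)) := by
  refine ⟨π, L, h.1, h.2.1, h.2.2.1, fun y => ?_⟩
  by_cases hy : y = x
  · subst hy; simpa using hS
  · simpa [Function.update_of_ne hy] using h.2.2.2 y

theorem sp_one {P : ℕ → Prop} {u : Node} (hu : u ∈ sp P) (m0 : ℕ) (hm0 : P m0) :
    ∃ m, P m ∧ u ∈ sp (fun a => a = m) := by
  rcases hu with rfl | ⟨m, j, hm, rfl⟩
  · exact ⟨m0, hm0, Or.inl rfl⟩
  · exact ⟨m, hm, Or.inr ⟨m, j, rfl, rfl⟩⟩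

theorem spider_equiv (AP : Type) (N : ℕ) (hN : ∃ m, m < N) (φ : MSOL AP) (hq : qr φ ≤ N) :
    Sat MPLdom (KS AP (fun _ => True) ⟨0, trivial⟩) (fun _ => []) (fun _ => ∅) φ ↔
    Sat MPLdom (KS AP (fun m => m < N) hN) (fun _ => []) (fun _ => ∅) φ := by
  have hN0 : 0 < N := by obtain ⟨m, hm⟩ := hN; omega
  refine ef_game MPLdom _ _ (fun _ => rfl) (fun _ => rfl) (RS N) ?_ ?_ ?_ ?_ ?_ ?_ φ N _ _ _ _ hq ?_
  · rintro k V1 V2 V1' V2' ⟨π, L, h1, h2, h3, h4⟩ x y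
    have a1 : ∀ x, V1 x ∈ sp (fun _ => True) := fun x => sp_mono (fun _ _ => trivial) (h3 x).1
    have a2 : ∀ x, V1' x ∈ sp (fun m => m < N) := fun x => by
      rw [(h3 x).2]; exact gp_sp π h2 (h3 x).1
    simp only [KS, a1, a2, true_and]
    rw [(h3 x).2, (h3 y).2, gp_prefix]
  · rintro k V1 V2 V1' V2' ⟨π, L, h1, h2, h3, h4⟩ x X
    rw [(h3 x).2, (h4 X).2, (gp_inj π).mem_set_image]
  · rintro k V1 V2 V1' V2' h x τ hτ
    obtain ⟨m, -, hm⟩ := sp_one hτ 0 trivial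
    obtain ⟨π, L, hmL, hx⟩ := RS_forth h m
    have hs : τ ∈ sp (fun m => m ∈ L) := sp_mono (by rintro _ rfl; exact hmL) hm
    exact ⟨gp π τ, gp_sp π hx.2.1 hs, RSx_upd1 hx x τ hs⟩
  · rintro k V1 V2 V1' V2' h x τ hτ
    obtain ⟨m, hmN, hm⟩ := sp_one hτ 0 hN0
    obtain ⟨π, L, hmL, hx⟩ := RS_back h m hmN
    have hs : gp π⁻¹ τ ∈ sp (fun m => m ∈ L) := gp_sp π⁻¹ (by rintro _ rfl; exact hmL) hm
    refine ⟨gp π⁻¹ τ, sp_mono (fun _ _ => trivial) hs, ?_⟩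
    have := RSx_upd1 hx x _ hs
    rwa [gp_inv] at this
  · rintro k V1 V2 V1' V2' h x S hS
    obtain ⟨m, -, hm⟩ := sp_path hS 0 trivial
    obtain ⟨π, L, hmL, hx⟩ := RS_forth h m
    have hs : S ⊆ sp (fun m => m ∈ L) := hm.trans (sp_mono (by rintro _ rfl; exact hmL))
    refine ⟨gp π '' S, gp_path π hS ?_, RSx_upd2 hx x S hs⟩
    rintro _ ⟨u, hu, rfl⟩
    exact gp_sp π hx.2.1 (hs hu)
  · rintro k V1 V2 V1' V2' h x S hS
    obtain ⟨m, hmN, hm⟩ := sp_path hS 0 hN0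
    obtain ⟨π, L, hmL, hx⟩ := RS_back h m hmN
    have hs : gp π⁻¹ '' S ⊆ sp (fun m => m ∈ L) := by
      rintro _ ⟨u, hu, rfl⟩
      exact gp_sp π⁻¹ (by rintro _ rfl; exact hmL) (hm hu)
    refine ⟨gp π⁻¹ '' S, gp_path π⁻¹ hS (hs.trans (sp_mono fun _ _ => trivial)), ?_⟩
    have := RSx_upd2 hx x _ hs
    rw [Set.image_image] at this
    simpa only [gp_inv, Set.image_id'] using this
  · exact ⟨1, ∅, by simp, by simp, fun _ => ⟨Or.inl rfl, rfl⟩, fun _ => ⟨by simp, by simp⟩⟩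

theorem WMTL_not_MPL (AP : Type) : ¬ MLogic.Leq (allKT AP) (WMTL AP) (MPL AP) := by
  intro h
  obtain ⟨φ, hs, -, hφ⟩ := h (phiS AP) (phiS_sentence AP) trivial
  have hN : ∃ m, m < qr φ + 1 := ⟨0, by omega⟩
  apply phiS_inf AP
  rw [hφ _ trivial, ksat_iff _ _ _ hs (fun _ => []) (fun _ => ∅)]
  refine (spider_equiv AP (qr φ + 1) hN φ (by omega)).2 ?_
  have := phiS_fin AP (qr φ + 1) hN
  rwa [hφ _ trivial, ksat_iff _ _ _ hs (fun _ => []) (fun _ => ∅)] at this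

def br (n : ℕ) (b : Bool) (t : ℕ) : ℕ := if b = true ∧ t = n then 1 else 0

def nd (n i : ℕ) (b : Bool) : Node := (List.range i).map (br n b)

theorem nd_length (n i : ℕ) (b : Bool) : (nd n i b).length = i := by simp [nd]

theorem nd_small {n i : ℕ} (h : i ≤ n) (b b' : Bool) : nd n i b = nd n i b' := by
  apply List.map_congr_left
  intro t ht
  have := List.mem_range.1 ht
  simp only [br]
  rw [if_neg (by omega), if_neg (by omega)]

theorem nd_mono {n i j : ℕ} (h : i ≤ j) (b : Bool) : nd n i b <+: nd n j b := by
  obtain ⟨c, rfl⟩ := Nat.exists_eq_add_of_le h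
  simp only [nd, List.range_add, List.map_append]
  exact List.prefix_append _ _

theorem nd_prefix_nd {n j : ℕ} {b : Bool} {u : Node} (h : u <+: nd n j b) :
    u = nd n u.length b := by
  have hn : u.length ≤ j := by simpa [nd] using h.length_le
  rw [List.prefix_iff_eq_take] at h
  conv_lhs => rw [h]
  simp [nd, ← List.map_take, List.take_range, hn]

theorem nd_prefix {n i j : ℕ} {b b' : Bool} :
    nd n i b <+: nd n j b' ↔ i ≤ j ∧ (i ≤ n ∨ b = b') := by
  constructor
  · intro h
    refine ⟨by simpa [nd] using h.length_le, ?_⟩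
    by_contra hc
    push Not at hc
    have h1 := nd_prefix_nd h
    rw [nd_length] at h1
    have h2 : (nd n i b)[n]'(by rw [nd_length]; omega) = (nd n i b')[n]'(by rw [nd_length]; omega) := by
      congr 1
    simp only [nd, List.getElem_map, List.getElem_range, br] at h2
    cases b <;> cases b' <;> simp at h2 hc
  · rintro ⟨h1, h2 | rfl⟩
    · rw [nd_small h2 b b']; exact nd_mono h1 b'
    · exact nd_mono h1 b

theorem nd_inj {n i j : ℕ} {b b' : Bool} (h : nd n i b = nd n j b') :
    i = j ∧ (i ≤ n ∨ b = b') := by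
  have h1 := (nd_prefix (n := n) (i := i) (j := j) (b := b) (b' := b')).1 (h ▸ List.prefix_refl _)
  have h2 := congrArg List.length h
  rw [nd_length, nd_length] at h2
  exact ⟨h2, h1.2⟩

def fk (n : ℕ) : Set Node := {u | ∃ i b, u = nd n i b}

theorem nd_fk (n i : ℕ) (b : Bool) : nd n i b ∈ fk n := ⟨i, b, rfl⟩

def KF (AP : Type) (n : ℕ) : KripkeTree AP where
  T := fk n
  root := []
  rooted := by
    refine ⟨⟨0, false, rfl⟩, fun τ _ => List.nil_prefix, ?_⟩
    rintro σ σ' ⟨i, b, h⟩ h'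
    simp only [List.nil_append] at *
    subst h
    exact ⟨_, b, nd_prefix_nd h'⟩
  nonblocking := by
    rintro τ ⟨i, b, rfl⟩
    exact ⟨br n b i, i + 1, b, by simp [nd, List.range_succ]⟩
  Lab := fun _ => ∅

theorem KF_fin (AP : Type) (n : ℕ) : KF AP n ∈ finBrKT AP := by
  intro τ _
  refine Set.Finite.subset (s := {τ ++ [0], τ ++ [1]}) (by simp) ?_
  rintro τ' ⟨⟨i, b, h⟩, a, rfl⟩
  have hn : a ∈ nd n i b := by rw [← h]; simp
  simp only [nd, List.mem_map, br] at hn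
  obtain ⟨t, -, rfl⟩ := hn
  split_ifs <;> simp

def fStem {AP : Type} (d u : ℕ) : MSOL AP := .not (.exFO u (.and (.not (.le d u)) (.not (.le u d))))

def phiF (AP : Type) : MSOL AP :=
  .exSO 0 (.exFO 0 (.exFO 1 (.and (.and (.mem 0 0) (.mem 1 0))
    (.and (.not (.exFO 2 (.not (.le 0 2))))
    (.and (.and (fStem 1 4) (.not (.exFO 2 (.and (fStem 2 4) (.not (.le 2 1))))))
      (.not (.exFO 2 (.exFO 3 (.and (.and (fLt 2 3) (.le 3 1))
        (.and (.not (.exFO 4 (.and (fLt 2 4) (fLt 4 3))))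
        (.and (.not (.and (.mem 2 0) (.not (.mem 3 0)))) (.not (.and (.not (.mem 2 0)) (.mem 3 0)))))))))))))) 

theorem phiF_sentence (AP : Type) : (phiF AP).IsSentence := by
  constructor
  · ext n
    simp only [phiF, fLt, fStem, MSOL.freeFO, Set.mem_sdiff, Set.mem_union, Set.mem_insert_iff, Set.mem_singleton_iff, Set.mem_empty_iff_false, iff_false]
    tauto
  · ext n
    simp only [phiF, fLt, fStem, MSOL.freeSO, Set.mem_sdiff, Set.mem_union, Set.mem_singleton_iff, Set.mem_empty_iff_false, iff_false]
    tauto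

def SLe (T : Set Node) (a b : Node) : Prop := a ∈ T ∧ b ∈ T ∧ a <+: b
def SStem (T : Set Node) (d : Node) : Prop := ¬ ∃ u ∈ T, ¬ SLe T d u ∧ ¬ SLe T u d

theorem phiF_sem (AP : Type) (K : KripkeTree AP) : (WMSO AP).KSat K (phiF AP) ↔
    ∃ S, (S ⊆ K.T ∧ S.Finite) ∧ ∃ r ∈ K.T, ∃ b ∈ K.T, (r ∈ S ∧ b ∈ S) ∧
      (¬ ∃ c ∈ K.T, ¬ SLe K.T r c) ∧
      (SStem K.T b ∧ ¬ ∃ c ∈ K.T, SStem K.T c ∧ ¬ SLe K.T c b) ∧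
      ¬ ∃ c ∈ K.T, ∃ d ∈ K.T, (SLt K.T c d ∧ SLe K.T d b) ∧
        (¬ ∃ e ∈ K.T, SLt K.T c e ∧ SLt K.T e d) ∧ ¬ (c ∈ S ∧ d ∉ S) ∧ ¬ (c ∉ S ∧ d ∈ S) := by
  rw [ksat_iff _ _ _ (phiF_sentence AP) (fun _ => []) (fun _ => ∅)]
  simp only [phiF, fLt, fStem, Sat, WMSO, weakDom, MSOdom, SLt, SLe, SStem]
  simp [Function.update]

theorem nd_SLe {n i j : ℕ} {b b' : Bool} :
    SLe (fk n) (nd n i b) (nd n j b') ↔ i ≤ j ∧ (i ≤ n ∨ b = b') := by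
  simp only [SLe, nd_fk, true_and, nd_prefix]

theorem nd_SLt {n i j : ℕ} {b b' : Bool} :
    SLt (fk n) (nd n i b) (nd n j b') ↔ i < j ∧ (i ≤ n ∨ b = b') := by
  simp only [SLt, nd_fk, true_and, nd_prefix]
  constructor
  · rintro ⟨⟨h1, h2⟩, h3⟩
    refine ⟨?_, h2⟩
    by_contra h
    apply h3
    refine ⟨by omega, ?_⟩
    rcases h2 with h2 | h2
    · left; omega
    · right; exact h2.symm
  · rintro ⟨h1, h2⟩
    exact ⟨⟨by omega, h2⟩, fun h => by omega⟩

theorem nd_SStem {n i : ℕ} {b : Bool} : SStem (fk n) (nd n i b) ↔ i ≤ n := by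
  constructor
  · intro h
    by_contra hi
    apply h
    refine ⟨nd n i (!b), nd_fk _ _ _, ?_, ?_⟩
    · rw [nd_SLe]; rintro ⟨-, h | h⟩
      · exact hi h
      · cases b <;> simp at h
    · rw [nd_SLe]; rintro ⟨-, h | h⟩
      · exact hi h
      · cases b <;> simp at h
  · rintro h ⟨_, ⟨j, b', rfl⟩, h1, h2⟩
    rw [nd_SLe] at h1 h2
    rcases le_total i j with hij | hij
    · exact h1 ⟨hij, Or.inl h⟩
    · exact h2 ⟨hij, Or.inl (by omega)⟩

theorem phiF_KF (AP : Type) (n : ℕ) : (WMSO AP).KSat (KF AP n) (phiF AP) ↔ Even n := by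
  rw [phiF_sem]
  have hT : (KF AP n).T = fk n := rfl
  rw [hT]
  constructor
  · rintro ⟨S, -, _, ⟨ir, br, rfl⟩, _, ⟨ib, bb, rfl⟩, ⟨hr, hb⟩, h1, ⟨h2, h3⟩, h4⟩
    rw [nd_SStem] at h2
    have hir : ir = 0 := by
      by_contra h
      apply h1
      refine ⟨nd n 0 false, nd_fk _ _ _, ?_⟩
      rw [nd_SLe]; omega
    subst hir
    have hib : ib = n := by
      by_contra h
      apply h3
      refine ⟨nd n n false, nd_fk _ _ _, ?_, ?_⟩
      · rw [nd_SStem]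
      · rw [nd_SLe]; omega
    subst hib
    have key : ∀ i ≤ ib, (nd ib i false ∈ S ↔ Even i) := by
      intro i
      induction i with
      | zero =>
        intro _
        rw [nd_small (Nat.zero_le _) br false] at hr
        simp [hr]
      | succ i ih =>
        intro hi
        have ih := ih (by omega)
        rw [Nat.even_add_one, ← ih]
        by_contra hc
        apply h4
        refine ⟨nd ib i false, nd_fk _ _ _, nd ib (i+1) false, nd_fk _ _ _, ⟨?_, ?_⟩, ?_, ?_⟩
        · rw [nd_SLt]; simp
        · rw [nd_SLe]; exact ⟨hi, Or.inl hi⟩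
        · rintro ⟨_, ⟨j, b', rfl⟩, e1, e2⟩
          rw [nd_SLt] at e1 e2
          omega
        · tauto
    rw [nd_small le_rfl bb false] at hb
    exact (key ib le_rfl).1 hb
  · intro hn
    refine ⟨(fun i => nd n i false) '' {i | i ≤ n ∧ Even i}, ⟨?_, ?_⟩, nd n 0 false, nd_fk _ _ _,
      nd n n false, nd_fk _ _ _, ⟨⟨0, by simp, rfl⟩, ⟨n, by simp [hn], rfl⟩⟩, ?_, ⟨?_, ?_⟩, ?_⟩
    · rintro _ ⟨i, -, rfl⟩; exact nd_fk _ _ _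
    · apply Set.Finite.image
      exact (Set.finite_Iic n).subset fun i hi => hi.1
    · rintro ⟨_, ⟨i, b, rfl⟩, h⟩
      rw [nd_SLe] at h; simp at h
    · rw [nd_SStem]
    · rintro ⟨_, ⟨i, b, rfl⟩, h1, h2⟩
      rw [nd_SStem] at h1
      rw [nd_SLe] at h2
      exact h2 ⟨h1, Or.inl h1⟩
    · rintro ⟨_, ⟨i, b, rfl⟩, _, ⟨j, b', rfl⟩, ⟨h1, h2⟩, h3, h4, h5⟩
      rw [nd_SLt] at h1
      rw [nd_SLe] at h2
      have hij : j = i + 1 := by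
        by_contra hne
        apply h3
        refine ⟨nd n (i+1) b', nd_fk _ _ _, ?_, ?_⟩
        · rw [nd_SLt]; exact ⟨by omega, Or.inl (by omega)⟩
        · rw [nd_SLt]; exact ⟨by omega, Or.inl (by omega)⟩
      subst hij
      have hmem : ∀ i ≤ n, ∀ b, (nd n i b ∈ (fun i => nd n i false) '' {i | i ≤ n ∧ Even i} ↔ Even i) := by
        intro i hi b
        rw [nd_small hi b false]
        constructor
        · rintro ⟨j, ⟨-, hj⟩, he⟩
          rw [← (nd_inj he).1]; exact hj
        · intro h; exact ⟨i, ⟨hi, h⟩, rfl⟩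
      rw [hmem i (by omega), hmem (i+1) (by omega), Nat.even_add_one] at h4 h5
      tauto

def sh (p i : ℕ) : ℕ := if i ≤ p then i else i + 1
def col (p i : ℕ) : ℕ := if i ≤ p then i else i - 1

def MM : ℕ → ℕ
  | 0 => 1
  | k + 1 => 3 * (MM k + 1)

theorem MM_pos (k : ℕ) : 1 ≤ MM k := by
  cases k <;> simp [MM]; omega

def Good (n p M : ℕ) (S S' : Set Node) : Prop :=
  (∀ i b, (i ≤ p ∨ p + M ≤ i) → (nd n i b ∈ S ↔ nd (n+1) (sh p i) b ∈ S')) ∧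
  (∀ i, p ≤ i → i ≤ p + M → (nd n i false ∈ S ↔ nd n p false ∈ S)) ∧
  (∀ i, p ≤ i → i ≤ p + M + 1 → (nd (n+1) i false ∈ S' ↔ nd (n+1) p false ∈ S'))

def RFx (n p M : ℕ) (V1 : ℕ → Node) (V2 : ℕ → Set Node) (V1' : ℕ → Node) (V2' : ℕ → Set Node) : Prop :=
  p + M ≤ n ∧
  (∀ x, ∃ i b, V1 x = nd n i b ∧ V1' x = nd (n+1) (sh p i) b ∧ (i ≤ p ∨ p + M ≤ i)) ∧
  (∀ X, Good n p M (V2 X) (V2' X))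

theorem Good_shrink {n p M p' M' : ℕ} {S S' : Set Node} (h : Good n p M S S') (hn : p + M ≤ n)
    (h1 : p ≤ p') (h2 : p' + M' ≤ p + M) (h3 : 1 ≤ M') : Good n p' M' S S' := by
  obtain ⟨g1, g2, g3⟩ := h
  refine ⟨?_, ?_, ?_⟩
  · intro i b hi
    by_cases hc : i ≤ p ∨ p + M ≤ i
    · rw [g1 i b hc]
      have : sh p i = sh p' i := by simp only [sh]; split_ifs <;> omega
      rw [this]
    · push Not at hc
      have e1 : sh p' i ≤ i + 1 ∧ i ≤ sh p' i := by simp only [sh]; split_ifs <;> omega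
      rw [nd_small (show i ≤ n by omega) b false, nd_small (show sh p' i ≤ n + 1 by omega) b false,
        g2 i (by omega) (by omega), g3 (sh p' i) (by omega) (by omega), g1 p false (Or.inl le_rfl)]
      simp [sh]
  · intro i a b
    rw [g2 i (by omega) (by omega), g2 p' (by omega) (by omega)]
  · intro i a b
    rw [g3 i (by omega) (by omega), g3 p' (by omega) (by omega)]

theorem RFx_shrink {n p M p' M' : ℕ} {V1 : ℕ → Node} {V2 : ℕ → Set Node} {V1' : ℕ → Node}
    {V2' : ℕ → Set Node} (h : RFx n p M V1 V2 V1' V2')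
    (h1 : p ≤ p') (h2 : p' + M' ≤ p + M) (h3 : 1 ≤ M') : RFx n p' M' V1 V2 V1' V2' := by
  obtain ⟨g1, g2, g3⟩ := h
  refine ⟨by omega, ?_, fun X => Good_shrink (g3 X) g1 h1 h2 h3⟩
  intro x
  obtain ⟨i, b, e1, e2, e3⟩ := g2 x
  have : sh p i = sh p' i := by simp only [sh]; split_ifs <;> omega
  exact ⟨i, b, e1, by rw [e2, this], by omega⟩

theorem RFx_upd1 {n p M : ℕ} {V1 : ℕ → Node} {V2 : ℕ → Set Node} {V1' : ℕ → Node}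
    {V2' : ℕ → Set Node} (h : RFx n p M V1 V2 V1' V2') (x i : ℕ) (b : Bool)
    (hi : i ≤ p ∨ p + M ≤ i) :
    RFx n p M (Function.update V1 x (nd n i b)) V2 (Function.update V1' x (nd (n+1) (sh p i) b)) V2' := by
  refine ⟨h.1, fun y => ?_, h.2.2⟩
  by_cases hy : y = x
  · subst hy; exact ⟨i, b, by simp, by simp, hi⟩
  · simpa only [Function.update_of_ne hy] using h.2.1 y

theorem RFx_upd2 {n p M : ℕ} {V1 : ℕ → Node} {V2 : ℕ → Set Node} {V1' : ℕ → Node}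
    {V2' : ℕ → Set Node} (h : RFx n p M V1 V2 V1' V2') (x : ℕ) (S S' : Set Node)
    (hS : Good n p M S S') :
    RFx n p M V1 (Function.update V2 x S) V1' (Function.update V2' x S') := by
  refine ⟨h.1, h.2.1, fun y => ?_⟩
  by_cases hy : y = x
  · subst hy; simpa using hS
  · simpa only [Function.update_of_ne hy] using h.2.2 y

theorem const_window (I : ℕ → Prop) (hI : ∀ a b c, a ≤ b → b ≤ c → I a → I c → I b) (p W : ℕ) :
    ∃ q, p ≤ q ∧ q + W ≤ p + 3 * W ∧ ∀ i, q ≤ i → i ≤ q + W → (I i ↔ I q) := by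
  by_contra hc
  push Not at hc
  have hin : ∀ q, p ≤ q → q + W ≤ p + 3 * W → ∃ i, q ≤ i ∧ i ≤ q + W ∧ I i := by
    intro q h1 h2
    obtain ⟨i, a, b, c⟩ := hc q h1 h2
    by_cases hi : I i
    · exact ⟨i, a, b, hi⟩
    · refine ⟨q, le_rfl, by omega, ?_⟩
      tauto
  obtain ⟨a, a1, a2, a3⟩ := hin p le_rfl (by omega)
  obtain ⟨c, c1, c2, c3⟩ := hin (p + 2 * W) (by omega) (by omega)
  obtain ⟨i, i1, i2, i3⟩ := hc (p + W) (by omega) (by omega)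
  have := hI a i c (by omega) (by omega) a3 c3
  have := hI a (p + W) c (by omega) (by omega) a3 c3
  tauto

theorem path_convex {n : ℕ} {S : Set Node} (hS : IsPathOf (fk n) S) :
    ∀ a b c, a ≤ b → b ≤ c → nd n a false ∈ S → nd n c false ∈ S → nd n b false ∈ S := by
  intro a b c h1 h2 ha hc
  exact (isPath_imp hS).2.2.2 _ ha _ hc _ (nd_mono h1 _) (nd_mono h2 _)

theorem fork_forth {n p M : ℕ} (hp : p + M ≤ n) {S : Set Node} (hS : IsPathOf (fk n) S)
    (hc : ∀ i, p ≤ i → i ≤ p + M → (nd n i false ∈ S ↔ nd n p false ∈ S)) :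
    ∃ S', IsPathOf (fk (n+1)) S' ∧ Good n p M S S' := by
  obtain ⟨hsub, hne, hch, hconv⟩ := isPath_imp hS
  have hmem : ∀ i b, nd (n+1) i b ∈ {u | ∃ i b, u = nd (n+1) i b ∧ nd n (col p i) b ∈ S} ↔
      nd n (col p i) b ∈ S := by
    intro i b
    constructor
    · rintro ⟨j, b', he, h⟩
      obtain ⟨rfl, h2 | rfl⟩ := nd_inj he
      · have : col p i ≤ n := by simp only [col]; split_ifs <;> omega
        rwa [nd_small this b b']
      · exact h
    · intro h; exact ⟨i, b, rfl, h⟩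
  have hcs : ∀ i, col p (sh p i) = i := by
    intro i; simp only [col, sh]; split_ifs <;> omega
  have hcol : ∀ i j, i ≤ j → col p i ≤ col p j := by
    intro i j h; simp only [col]; split_ifs <;> omega
  have hcn : ∀ i, col p i ≤ n ↔ i ≤ n + 1 := by
    intro i; simp only [col]; split_ifs <;> omega
  refine ⟨{u | ∃ i b, u = nd (n+1) i b ∧ nd n (col p i) b ∈ S}, ?_, ?_, hc, ?_⟩
  · apply isPath_of
    · rintro _ ⟨i, b, rfl, -⟩; exact nd_fk _ _ _
    · obtain ⟨u, hu⟩ := hne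
      obtain ⟨i, b, rfl⟩ := hsub hu
      exact ⟨nd (n+1) (sh p i) b, by rw [hmem, hcs]; exact hu⟩
    · rintro _ ⟨i, b, rfl, h1⟩ _ ⟨j, b', rfl, h2⟩
      have h3 := hch _ h1 _ h2
      simp only [nd_prefix, hcn] at h3 ⊢
      rcases le_total i j with h | h
      · left
        refine ⟨h, ?_⟩
        rcases h3 with ⟨-, h3⟩ | ⟨-, h3 | h3⟩
        · exact h3
        · left; omega
        · right; exact h3.symm
      · right
        refine ⟨h, ?_⟩
        rcases h3 with ⟨-, h3 | h3⟩ | ⟨-, h3⟩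
        · left; omega
        · right; exact h3.symm
        · exact h3
    · rintro _ ⟨i, b, rfl, h1⟩ _ ⟨j, b', rfl, h2⟩ ρ h3 h4
      have he := nd_prefix_nd h4
      rw [he] at h3 h4 ⊢
      rw [hmem]
      rw [nd_prefix] at h3 h4
      refine hconv _ h1 _ h2 _ ?_ ?_
      · rw [nd_prefix, hcn]; exact ⟨hcol _ _ h3.1, h3.2⟩
      · rw [nd_prefix]; exact ⟨hcol _ _ h4.1, Or.inr rfl⟩
  · intro i b _
    rw [hmem, hcs]
  · intro i h1 h2
    have e1 : p ≤ col p i ∧ col p i ≤ p + M := by simp only [col]; split_ifs <;> omega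
    have e2 : col p p = p := by simp [col]
    rw [hmem, hmem, e2]
    exact hc _ e1.1 e1.2

theorem fork_back {n p M : ℕ} (hp : p + M ≤ n) {S' : Set Node} (hS : IsPathOf (fk (n+1)) S')
    (hc : ∀ i, p ≤ i → i ≤ p + M + 1 → (nd (n+1) i false ∈ S' ↔ nd (n+1) p false ∈ S')) :
    ∃ S, IsPathOf (fk n) S ∧ Good n p M S S' := by
  obtain ⟨hsub, hne, hch, hconv⟩ := isPath_imp hS
  have hmem : ∀ i b, nd n i b ∈ {u | ∃ i b, u = nd n i b ∧ nd (n+1) (sh p i) b ∈ S'} ↔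
      nd (n+1) (sh p i) b ∈ S' := by
    intro i b
    constructor
    · rintro ⟨j, b', he, h⟩
      obtain ⟨rfl, h2 | rfl⟩ := nd_inj he
      · have : sh p i ≤ n + 1 := by simp only [sh]; split_ifs <;> omega
        rwa [nd_small this b b']
      · exact h
    · intro h; exact ⟨i, b, rfl, h⟩
  have hsh : ∀ i j, sh p i ≤ sh p j ↔ i ≤ j := by
    intro i j; simp only [sh]; split_ifs <;> omega
  have hsn : ∀ i, sh p i ≤ n + 1 ↔ i ≤ n := by
    intro i; simp only [sh]; split_ifs <;> omega
  have e2 : sh p p = p := by simp [sh]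
  refine ⟨{u | ∃ i b, u = nd n i b ∧ nd (n+1) (sh p i) b ∈ S'}, ?_, ?_, ?_, hc⟩
  · apply isPath_of
    · rintro _ ⟨i, b, rfl, -⟩; exact nd_fk _ _ _
    · obtain ⟨u, hu⟩ := hne
      obtain ⟨i, b, rfl⟩ := hsub hu
      by_cases hi : i = p + 1
      · subst hi
        refine ⟨nd n p false, ?_⟩
        rw [hmem, e2, ← hc (p+1) (by omega) (by omega), nd_small (by omega) false b]
        exact hu
      · refine ⟨nd n (col p i) b, ?_⟩
        have : sh p (col p i) = i := by simp only [col, sh]; split_ifs <;> omega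
        rw [hmem, this]; exact hu
    · rintro _ ⟨i, b, rfl, h1⟩ _ ⟨j, b', rfl, h2⟩
      have h3 := hch _ h1 _ h2
      simpa only [nd_prefix, hsh, hsn] using h3
    · rintro _ ⟨i, b, rfl, h1⟩ _ ⟨j, b', rfl, h2⟩ ρ h3 h4
      have he := nd_prefix_nd h4
      rw [he] at h3 h4 ⊢
      rw [hmem]
      rw [nd_prefix] at h3 h4
      refine hconv _ h1 _ h2 _ ?_ ?_
      · rw [nd_prefix, hsh, hsn]; exact h3
      · rw [nd_prefix, hsh]; exact ⟨h4.1, Or.inr rfl⟩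
  · intro i b _
    rw [hmem]
  · intro i h1 h2
    have e1 : p ≤ sh p i ∧ sh p i ≤ p + M + 1 := by simp only [sh]; split_ifs <;> omega
    rw [hmem, hmem, e2]
    exact hc _ e1.1 e1.2

theorem fork_equiv (AP : Type) (n : ℕ) (φ : MSOL AP) (hn : MM (qr φ) ≤ n) :
    Sat MPLdom (KF AP n) (fun _ => []) (fun _ => ∅) φ ↔
    Sat MPLdom (KF AP (n+1)) (fun _ => []) (fun _ => ∅) φ := by
  refine ef_game MPLdom _ _ (fun _ => rfl) (fun _ => rfl)
    (fun k V1 V2 V1' V2' => ∃ p, RFx n p (MM k) V1 V2 V1' V2')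
    ?_ ?_ ?_ ?_ ?_ ?_ φ (qr φ) _ _ _ _ le_rfl ?_
  · rintro k V1 V2 V1' V2' ⟨p, h1, h2, h3⟩ x y
    obtain ⟨i, b, e1, e2, e3⟩ := h2 x
    obtain ⟨j, b', f1, f2, f3⟩ := h2 y
    have hsh : sh p i ≤ sh p j ↔ i ≤ j := by
      simp only [sh]; split_ifs <;> omega
    have hsn : sh p i ≤ n + 1 ↔ i ≤ n := by
      simp only [sh]; split_ifs <;> omega
    simp only [KF]
    rw [e1, e2, f1, f2]
    simp only [nd_fk, true_and, nd_prefix, hsh, hsn]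
  · rintro k V1 V2 V1' V2' ⟨p, h1, h2, h3⟩ x X
    obtain ⟨i, b, e1, e2, e3⟩ := h2 x
    rw [e1, e2]
    exact (h3 X).1 i b e3
  · rintro k V1 V2 V1' V2' ⟨p, h⟩ x _ ⟨i, b, rfl⟩
    have hM : MM (k+1) = 3 * (MM k + 1) := rfl
    have hpos := MM_pos k
    by_cases hi : i ≤ p + MM k
    · exact ⟨_, nd_fk _ _ _, p + MM k, RFx_upd1 (RFx_shrink h (by omega) (by omega) hpos) x i b (Or.inl hi)⟩
    · exact ⟨_, nd_fk _ _ _, p, RFx_upd1 (RFx_shrink h (by omega) (by omega) hpos) x i b (Or.inr (by omega))⟩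
  · rintro k V1 V2 V1' V2' ⟨p, h⟩ x _ ⟨i, b, rfl⟩
    have hM : MM (k+1) = 3 * (MM k + 1) := rfl
    have hpos := MM_pos k
    by_cases hi : i ≤ p + MM k
    · have := RFx_upd1 (RFx_shrink h (p' := p + MM k) (by omega) (by omega) hpos) x i b (Or.inl hi)
      have e : sh (p + MM k) i = i := by simp [sh, hi]
      rw [e] at this
      exact ⟨_, nd_fk _ _ _, p + MM k, this⟩
    · have := RFx_upd1 (RFx_shrink h (p' := p) (by omega) (by omega) hpos) x (i-1) b (Or.inr (by omega))
      have e : sh p (i-1) = i := by simp only [sh]; split_ifs <;> omega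
      rw [e] at this
      exact ⟨_, nd_fk _ _ _, p, this⟩
  · rintro k V1 V2 V1' V2' ⟨p, h⟩ x S hS
    have hM : MM (k+1) = 3 * (MM k + 1) := rfl
    have hpos := MM_pos k
    have hpn := h.1
    obtain ⟨q, q1, q2, q3⟩ := const_window (fun i => nd n i false ∈ S) (path_convex hS) p (MM k + 1)
    obtain ⟨S', hS', hg⟩ := fork_forth (p := q) (M := MM k) (by omega) hS
      (fun i a b => q3 i a (by omega))
    exact ⟨S', hS', q, RFx_upd2 (RFx_shrink h q1 (by omega) hpos) x S S' hg⟩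
  · rintro k V1 V2 V1' V2' ⟨p, h⟩ x S' hS'
    have hM : MM (k+1) = 3 * (MM k + 1) := rfl
    have hpos := MM_pos k
    have hpn := h.1
    obtain ⟨q, q1, q2, q3⟩ := const_window (fun i => nd (n+1) i false ∈ S') (path_convex hS') p (MM k + 1)
    obtain ⟨S, hS, hg⟩ := fork_back (p := q) (M := MM k) (by omega) hS'
      (fun i a b => q3 i a (by omega))
    exact ⟨S, hS, q, RFx_upd2 (RFx_shrink h q1 (by omega) hpos) x S S' hg⟩
  · refine ⟨0, by omega, fun _ => ⟨0, false, rfl, rfl, Or.inl le_rfl⟩, fun _ => ⟨?_, ?_, ?_⟩⟩ <;> simp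

theorem WMSO_not_MPL (AP : Type) : ¬ MLogic.Leq (finBrKT AP) (WMSO AP) (MPL AP) := by
  intro h
  obtain ⟨φ, hs, -, hφ⟩ := h (phiF AP) (phiF_sentence AP) trivial
  have h1 := fork_equiv AP (MM (qr φ)) φ le_rfl
  have h2 := hφ _ (KF_fin AP (MM (qr φ)))
  have h3 := hφ _ (KF_fin AP (MM (qr φ) + 1))
  rw [phiF_KF, ksat_iff _ _ _ hs (fun _ => []) (fun _ => ∅)] at h2 h3
  have h4 : Even (MM (qr φ)) ↔ Even (MM (qr φ) + 1) := h2.trans (h1.trans h3.symm)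
  rw [Nat.even_add_one] at h4
  tauto

/-- over all Kripke trees, MPL ≁ WMTL and MPL ≁ WMSO;
over finitely-branching Kripke trees, MPL ≰ WMTL and MPL ≁ WMSO. -/
theorem stmt15 (AP : Type) [Fintype AP] :
    MLogic.Incomp (allKT AP) (MPL AP) (WMTL AP) ∧
    MLogic.Incomp (allKT AP) (MPL AP) (WMSO AP) ∧
    ¬ MLogic.Leq (finBrKT AP) (MPL AP) (WMTL AP) ∧
    MLogic.Incomp (finBrKT AP) (MPL AP) (WMSO AP) := by
  have a1 : ¬ MLogic.Leq (finBrKT AP) (MPL AP) (WMTL AP) :=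
    MPL_not_weak AP (WMTL AP) IsTree fun T S => by simp [WMTL, weakDom, MTLdom, and_assoc]
  have a2 : ¬ MLogic.Leq (finBrKT AP) (MPL AP) (WMSO AP) :=
    MPL_not_weak AP (WMSO AP) (fun _ => True) fun T S => by simp [WMSO, weakDom, MSOdom]
  have a3 := WMSO_not_MPL AP
  exact ⟨⟨Leq_mono _ _ a1, WMTL_not_MPL AP⟩, ⟨Leq_mono _ _ a2, Leq_mono _ _ a3⟩, a1, a2, a3⟩
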